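/- For every natural number n such that 24 divides 5n+1, the number spt((5n+1)/24) is divisible by 5. -/

import Mathlib

open Finset

/-- `spt n`: the total number of smallest parts in the partitions of `n`,
i.e. the sum over all partitions of `n` of the multiplicity of the smallest part. -/
def spt (n : ℕ) : ℕ :=
  ∑ p : Nat.Partition n, (p.parts.filter (fun j => ∀ i ∈ p.parts, j ≤ i)).card

namespace SptCongruence

open PowerSeries
open scoped PowerSeries.WithPiTopology

instance factPrimeFive : Fact (Nat.Prime 5) := ⟨by norm_num⟩

/-- Power series in `q` over the field with five elements. -/
abbrev A := PowerSeries (ZMod 5)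

/-- The fraction field of `A⟦s⟧`, in which rational identities are verified. -/
abbrev Fr := FractionRing (PowerSeries A)

/-- The inclusion of `A` in `Fr`. -/
noncomputable def toFr : A →+* Fr := (algebraMap (PowerSeries A) Fr).comp C

/-- The variable `q` in `Fr`. -/
noncomputable def q : Fr := toFr X

lemma toFr_injective : Function.Injective toFr :=
  (IsFractionRing.injective (PowerSeries A) Fr).comp C_injective

@[simp] lemma toFr_X : toFr X = q := rfl

lemma q_ne_zero : q ≠ 0 := by
  intro h
  exact X_ne_zero (toFr_injective (h.trans (map_zero toFr).symm))

lemma q_pow_ne_one {n : ℕ} (hn : n ≠ 0) : q ^ n ≠ 1 := by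
  intro h
  have h1 : (X : A) ^ n = 1 := toFr_injective (by simpa using h)
  have := congrArg constantCoeff h1
  simp [hn] at this

lemma q_zpow_ne_one {n : ℤ} (hn : n ≠ 0) : q ^ n ≠ 1 := by
  rcases Int.natAbs_eq n with h | h
  · rw [h, zpow_natCast]
    exact q_pow_ne_one (by omega)
  · rw [h, zpow_neg, zpow_natCast, Ne, inv_eq_one]
    exact q_pow_ne_one (by omega)

lemma one_sub_q_zpow_ne_zero {n : ℤ} (hn : n ≠ 0) : 1 - q ^ n ≠ 0 :=
  sub_ne_zero.2 (q_zpow_ne_one hn).symm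

lemma five_eq_zero : (5 : A) = 0 := by
  have h : (5 : ZMod 5) = 0 := rfl
  rw [← map_ofNat (C (R := ZMod 5)) 5, h, map_zero]

/-! ### Convergence -/

lemma eq_zero_of_forall_dvd {a : A} (h : ∀ M : ℕ, X ^ M ∣ a) : a = 0 := by
  ext n
  exact X_pow_dvd_iff.1 (h (n + 1)) n (by omega)

lemma eq_of_forall_dvd_sub {a b : A} (h : ∀ M : ℕ, X ^ M ∣ a - b) : a = b :=
  sub_eq_zero.1 (eq_zero_of_forall_dvd h)

/-- A family of power series whose `n`-th term has order at least `|n| - 1`. -/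
def Small (f : ℤ → A) : Prop := ∀ n, X ^ (n.natAbs - 1) ∣ f n

lemma Small.mul_right {f : ℤ → A} (h : Small f) (g : ℤ → A) : Small fun n => f n * g n :=
  fun n => (h n).mul_right _

lemma Small.coeff_eq_zero {f : ℤ → A} (h : Small f) {k : ℕ} {n : ℤ} (hn : k + 1 < n.natAbs) :
    coeff k (f n) = 0 :=
  X_pow_dvd_iff.1 (h n) k (by omega)

lemma Small.summable {f : ℤ → A} (h : Small f) : Summable f := by
  rw [WithPiTopology.summable_iff_summable_coeff]
  intro k
  refine summable_of_ne_finset_zero (s := Icc (-(k + 1 : ℤ)) (k + 1)) fun n hn => ?_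
  exact h.coeff_eq_zero (by simp only [mem_Icc] at hn; omega)

/-- The weighted sums of a small family converge in `A⟦s⟧`. -/
lemma Small.summable_C_mul {f : ℤ → A} (h : Small f) (G : ℤ → PowerSeries A) :
    Summable fun n => C (f n) * G n := by
  rw [WithPiTopology.summable_iff_summable_coeff]
  intro k
  simp only [coeff_C_mul]
  exact (h.mul_right _).summable

lemma coeff_tsum_C_mul {f : ℤ → A} (h : Small f) (G : ℤ → PowerSeries A) (k : ℕ) :
    coeff k (∑' n, C (f n) * G n) = ∑' n, f n * coeff k (G n) := by
  have := ((WithPiTopology.hasSum_iff_hasSum_coeff _).1 (h.summable_C_mul G).hasSum k).tsum_eq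
  simpa only [coeff_C_mul] using this.symm

lemma dvd_tsum {f : ℤ → A} {M : ℕ} (h : ∀ n, X ^ M ∣ f n) : X ^ M ∣ ∑' n, f n := by
  by_cases hf : Summable f
  · rw [X_pow_dvd_iff]
    intro k hk
    have := ((WithPiTopology.hasSum_iff_hasSum_coeff _).1 hf.hasSum k).tsum_eq
    rw [← this]
    simp [X_pow_dvd_iff.1 (h _) k hk]
  · simp [tsum_eq_zero_of_not_summable hf]

lemma Small.dvd_sum_sub_tsum {f : ℤ → A} (h : Small f) (M : ℕ) :
    X ^ M ∣ ∑ n ∈ Icc (-(M : ℤ)) M, f n - ∑' n, f n := by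
  have h1 : ∑ n ∈ Icc (-(M : ℤ)) M, f n = ∑' n, if n ∈ Icc (-(M : ℤ)) M then f n else 0 := by
    rw [tsum_eq_sum (s := Icc (-(M : ℤ)) M) (fun n hn => if_neg hn)]
    exact sum_congr rfl fun n hn => (if_pos hn).symm
  have h2 : Small fun n => if n ∈ Icc (-(M : ℤ)) M then f n else 0 := fun n => by
    dsimp only
    split_ifs
    · exact h n
    · exact dvd_zero _
  rw [h1, ← h2.summable.tsum_sub h.summable]
  refine dvd_tsum fun n => ?_
  split_ifs with hn
  · simp
  · rw [zero_sub, dvd_neg]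
    refine (pow_dvd_pow _ ?_).trans (h n)
    simp only [mem_Icc] at hn
    omega

/-- A family of weights tending to `1` does not change the limit of a small sum. -/
lemma dvd_tsum_mul_sub {f w : ℤ → A} (h : Small f) {M : ℕ}
    (hw : ∀ n : ℤ, X ^ (M + 1 - n.natAbs) ∣ w n - 1) :
    X ^ M ∣ ∑' n, f n * w n - ∑' n, f n := by
  rw [← (h.mul_right w).summable.tsum_sub h.summable]
  refine dvd_tsum fun n => ?_
  rw [← mul_sub_one]
  refine dvd_trans ?_ (mul_dvd_mul (h n) (hw n))
  rw [← pow_add]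
  exact pow_dvd_pow _ (by omega)

/-! ### The operator `q d/dq` -/

/-- The derivation `q d/dq`. -/
noncomputable def Θ : Derivation (ZMod 5) A A := (X : A) • derivative (ZMod 5)

lemma Θ_apply (f : A) : Θ f = X * derivative (ZMod 5) f := rfl

lemma coeff_Θ (f : A) (n : ℕ) : coeff n (Θ f) = n * coeff n f := by
  rw [Θ_apply]
  cases n with
  | zero => simp
  | succ n => rw [coeff_succ_X_mul, coeff_derivative]; push_cast; ring

lemma Θ_X_pow (n : ℕ) : Θ ((X : A) ^ n) = n * (X : A) ^ n := by
  ext k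
  rw [coeff_Θ, ← map_natCast (C (R := ZMod 5)) n, coeff_C_mul, coeff_X_pow]
  split_ifs with h <;> simp [h]

lemma Θ_mul (f g : A) : Θ (f * g) = Θ f * g + f * Θ g := by
  rw [Derivation.leibniz]; simp only [smul_eq_mul]; ring

lemma Θ_intCast (n : ℤ) : Θ (n : A) = 0 := by
  simp

lemma Θ_tsum {f : ℤ → A} (h : Small f) : Θ (∑' n, f n) = ∑' n, Θ (f n) := by
  ext k
  have h1 := (WithPiTopology.hasSum_iff_hasSum_coeff _).1 h.summable.hasSum k
  have h2 : Small fun n => Θ (f n) := fun n => by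
    rw [X_pow_dvd_iff]
    intro m hm
    rw [coeff_Θ, X_pow_dvd_iff.1 (h n) m hm, mul_zero]
  have h3 := (WithPiTopology.hasSum_iff_hasSum_coeff _).1 h2.summable.hasSum k
  rw [coeff_Θ, ← h3.tsum_eq, ← h1.tsum_eq, ← tsum_mul_left]
  simp only [coeff_Θ]

/-! ### The functions `1 / (1 - q ^ n)` and the theta coefficients -/

/-- `d n = 1 / (1 - q ^ n)` for `n ≠ 0`, and `d 0 = 0`. -/
noncomputable def d : ℤ → A
  | Int.ofNat n => (1 - X ^ n)⁻¹
  | Int.negSucc n => 1 - (1 - X ^ (n + 1))⁻¹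

lemma toFr_inv_one_sub_X_pow (n : ℕ) : toFr (1 - X ^ n)⁻¹ = (1 - q ^ n)⁻¹ := by
  rcases eq_or_ne n 0 with rfl | hn
  · simp
  · refine eq_inv_of_mul_eq_one_left ?_
    have h : (1 - X ^ n : A)⁻¹ * (1 - X ^ n) = 1 := PowerSeries.inv_mul_cancel _ (by simp [hn])
    simpa using congrArg toFr h

lemma toFr_d (n : ℤ) : toFr (d n) = (1 - q ^ n)⁻¹ := by
  cases n with
  | ofNat n => simpa [d] using toFr_inv_one_sub_X_pow n
  | negSucc n =>
    have h := q_pow_ne_one (Nat.succ_ne_zero n)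
    have h1 : 1 - q ^ (n + 1) ≠ 0 := sub_ne_zero.2 h.symm
    have h2 : q ^ (n + 1) - 1 ≠ 0 := sub_ne_zero.2 h
    have h3 := q_ne_zero
    simp only [d, map_sub, map_one, toFr_inv_one_sub_X_pow, zpow_negSucc]
    have h4 : 1 - (q ^ (n + 1))⁻¹ ≠ 0 := by
      rw [sub_ne_zero, Ne, eq_comm, inv_eq_one]; exact h
    field_simp
    ring

@[simp] lemma d_zero : d 0 = 0 := toFr_injective (by simp [toFr_d])

lemma one_sub_q_zpow_neg (n : ℤ) : 1 - q ^ (-n) = -(1 - q ^ n) * q ^ (-n) := by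
  have := zpow_ne_zero n q_ne_zero
  rw [zpow_neg]; field_simp; ring

/-- `e n = q ^ n / (1 - q ^ n)` for `n ≠ 0`, and `e 0 = 0`. -/
noncomputable def e (n : ℤ) : A := -d (-n)

lemma toFr_e (n : ℤ) : toFr (e n) = q ^ n * (1 - q ^ n)⁻¹ := by
  rw [e, map_neg, toFr_d, one_sub_q_zpow_neg, mul_inv, ← zpow_neg, neg_neg, neg_inv.symm]
  ring

@[simp] lemma e_zero : e 0 = 0 := by simp [e]

lemma e_neg (n : ℤ) : e (-n) = -d n := by simp [e]

lemma d_neg (n : ℤ) : d (-n) = -e n := by simp [e]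

lemma e_eq {n : ℤ} (hn : n ≠ 0) : e n = d n - 1 := by
  apply toFr_injective
  have := one_sub_q_zpow_ne_zero hn
  rw [map_sub, map_one, toFr_e, toFr_d]
  field_simp
  ring

lemma d_add_d_neg {n : ℤ} (hn : n ≠ 0) : d n + d (-n) = 1 := by
  rw [d_neg, e_eq hn]; ring

lemma d_mul_e (n : ℤ) : d n * e n = d n * (d n - 1) := by
  rcases eq_or_ne n 0 with rfl | hn
  · simp
  · rw [e_eq hn]

lemma e_mul_d (n : ℤ) : e n * d n = e n * (e n + 1) := by
  rcases eq_or_ne n 0 with rfl | hn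
  · simp
  · rw [e_eq hn]; ring

/-- The partial fraction relation between `1 / (1 - q ^ n)` and `1 / (1 - q ^ m)`. -/
lemma d_mul_d {n m : ℤ} (hn : n ≠ 0) (hm : m ≠ 0) (hnm : n ≠ m) :
    d n * d m = d (m - n) * d n + d (n - m) * d m := by
  apply toFr_injective
  have h1 := one_sub_q_zpow_ne_zero hn
  have h2 := one_sub_q_zpow_ne_zero hm
  have h3 : q ^ n - q ^ m ≠ 0 := by
    intro h
    refine q_zpow_ne_one (sub_ne_zero.2 hnm) ?_
    rw [zpow_sub₀ q_ne_zero, sub_eq_zero.1 h, div_self (zpow_ne_zero _ q_ne_zero)]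
  have h3' : q ^ m - q ^ n ≠ 0 := by rw [← neg_sub]; exact neg_ne_zero.2 h3
  have h4 := zpow_ne_zero n q_ne_zero
  have h5 := zpow_ne_zero m q_ne_zero
  simp only [map_add, map_mul, toFr_d, zpow_sub₀ q_ne_zero]
  have h6 : 1 - q ^ m / q ^ n = (q ^ n - q ^ m) / q ^ n := by field_simp
  have h7 : 1 - q ^ n / q ^ m = -(q ^ n - q ^ m) / q ^ m := by field_simp; ring
  rw [h6, h7]
  field_simp
  ring

lemma Θ_d (n : ℤ) : Θ (d n) = n * (d n * e n) := by
  have key : ∀ k : ℕ, Θ (1 - X ^ k : A)⁻¹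
      = k * ((1 - X ^ k : A)⁻¹ * ((1 - X ^ k : A)⁻¹ - 1)) := by
    intro k
    rcases eq_or_ne k 0 with rfl | hk
    · simp
    · have h : (1 - X ^ k : A) * (1 - X ^ k : A)⁻¹ = 1 :=
        PowerSeries.mul_inv_cancel _ (by simp [hk])
      have h2 := congrArg Θ h
      rw [Θ_mul, map_sub, Θ_X_pow, Derivation.map_one_eq_zero, zero_sub] at h2
      set y := (1 - X ^ k : A)⁻¹
      linear_combination y * h2 - (k * y + Θ y) * h
  cases n with
  | ofNat n => rw [d_mul_e]; simpa [d] using key n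
  | negSucc n =>
    rw [d_mul_e, d, map_sub, key, Derivation.map_one_eq_zero]
    push_cast [Int.cast_negSucc]
    ring

/-- `τ n = (-1) ^ n q ^ (n (n + 1) / 2)`. -/
noncomputable def τ (n : ℤ) : A := (-1) ^ n.natAbs * X ^ (n * (n + 1) / 2).toNat

/-- `T n = (-1) ^ n q ^ (n (3 n + 1) / 2)`. -/
noncomputable def T (n : ℤ) : A := (-1) ^ n.natAbs * X ^ (n * (3 * n + 1) / 2).toNat

lemma neg_one_pow_natAbs (n : ℤ) : (-1 : Fr) ^ n.natAbs = (-1) ^ n := by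
  rcases Int.natAbs_eq n with h | h
  · conv_rhs => rw [h, zpow_natCast]
  · conv_rhs => rw [h, zpow_neg, zpow_natCast, ← inv_pow, inv_neg_one]

lemma two_mul_triangle (n : ℤ) : 2 * (n * (n + 1) / 2) = n * (n + 1) :=
  Int.two_mul_ediv_two_of_even (Int.even_mul_succ_self n)

lemma two_mul_pentagon (n : ℤ) : 2 * (n * (3 * n + 1) / 2) = n * (3 * n + 1) := by
  refine Int.two_mul_ediv_two_of_even ?_
  rcases Int.even_or_odd n with h | h
  · exact h.mul_right _
  · exact (((by decide : Odd (3 : ℤ)).mul h).add_odd odd_one).mul_left _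

lemma triangle_bound (n : ℤ) : n.natAbs - 1 ≤ (n * (n + 1) / 2).toNat := by
  have := two_mul_triangle n
  have h1 := Int.le_self_sq n
  have h2 := Int.le_self_sq (-n - 1)
  rcases le_or_gt 0 n with h | h
  · have : n ≤ n * (n + 1) / 2 := by nlinarith only [this, h, h1, h2]
    omega
  · have : -n - 1 ≤ n * (n + 1) / 2 := by nlinarith only [this, h, h1, h2]
    omega

lemma pentagon_bound (n : ℤ) : n.natAbs - 1 ≤ (n * (3 * n + 1) / 2).toNat := by
  have := two_mul_pentagon n
  have h1 := Int.le_self_sq n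
  have h2 := Int.le_self_sq (-n - 1)
  rcases le_or_gt 0 n with h | h
  · have : n ≤ n * (3 * n + 1) / 2 := by nlinarith only [this, h, h1, h2]
    omega
  · have : -n - 1 ≤ n * (3 * n + 1) / 2 := by nlinarith only [this, h, h1, h2]
    omega

lemma triangle_nonneg (n : ℤ) : 0 ≤ n * (n + 1) / 2 := by
  have := two_mul_triangle n
  rcases le_or_gt 0 n with h | h <;> nlinarith

lemma pentagon_nonneg (n : ℤ) : 0 ≤ n * (3 * n + 1) / 2 := by
  have := two_mul_pentagon n
  rcases le_or_gt 0 n with h | h <;> nlinarith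

lemma τ_small : Small τ := fun n =>
  ((pow_dvd_pow _ (triangle_bound n)).trans (dvd_mul_left _ _))

lemma T_small : Small T := fun n =>
  ((pow_dvd_pow _ (pentagon_bound n)).trans (dvd_mul_left _ _))

lemma toFr_τ (n : ℤ) : toFr (τ n) = (-1) ^ n * q ^ (n * (n + 1) / 2) := by
  rw [τ, map_mul, map_pow, map_pow, map_neg, map_one, neg_one_pow_natAbs, toFr_X,
    ← zpow_natCast q, Int.toNat_of_nonneg (triangle_nonneg n)]

lemma toFr_T (n : ℤ) : toFr (T n) = (-1) ^ n * q ^ (n * (3 * n + 1) / 2) := by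
  rw [T, map_mul, map_pow, map_pow, map_neg, map_one, neg_one_pow_natAbs, toFr_X,
    ← zpow_natCast q, Int.toNat_of_nonneg (pentagon_nonneg n)]

@[simp] lemma τ_zero : τ 0 = 1 := by simp [τ]

@[simp] lemma T_zero : T 0 = 1 := by simp [T]

lemma toFr_τ_add_one (n : ℤ) : toFr (τ (n + 1)) = -(q ^ (n + 1) * toFr (τ n)) := by
  have h : (n + 1) * (n + 1 + 1) / 2 = n * (n + 1) / 2 + (n + 1) := by
    have h1 := two_mul_triangle n
    have h2 := two_mul_triangle (n + 1)
    have : (n + 1) * (n + 1 + 1) = n * (n + 1) + 2 * (n + 1) := by ring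
    omega
  rw [toFr_τ, toFr_τ, h, zpow_add₀ q_ne_zero, zpow_add_one₀ (by norm_num)]
  ring

lemma τ_reflect (n : ℤ) : τ (-1 - n) = -τ n := by
  apply toFr_injective
  have h : (-1 - n) * (-1 - n + 1) = n * (n + 1) := by ring
  rw [map_neg, toFr_τ, toFr_τ, h, zpow_sub₀ (by norm_num)]
  have : ((-1 : Fr) ^ n)⁻¹ = (-1) ^ n := by rw [← inv_zpow, inv_neg_one]
  rw [div_eq_mul_inv, this]
  simp

lemma toFr_τ_neg (n : ℤ) : toFr (τ (-n)) = q ^ (-n) * toFr (τ n) := by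
  have h1 := τ_reflect (n - 1)
  have h2 := toFr_τ_add_one (n - 1)
  rw [show -1 - (n - 1) = -n by ring] at h1
  rw [sub_add_cancel] at h2
  rw [h1, h2, map_neg, zpow_neg]
  have := zpow_ne_zero n q_ne_zero
  field_simp

lemma toFr_T_mul (n : ℤ) : toFr (T n) * q ^ n = toFr (τ n) ^ 3 := by
  have h : 3 * (n * (n + 1) / 2) = n * (3 * n + 1) / 2 + n := by
    have h1 := two_mul_triangle n
    have h2 := two_mul_pentagon n
    have : 3 * (n * (n + 1)) = n * (3 * n + 1) + 2 * n := by ring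
    omega
  have h' : (-1 : Fr) ^ n = ((-1 : Fr) ^ n) ^ 3 := by
    have : ((-1 : Fr) ^ n) ^ 2 = 1 := by
      rw [← zpow_natCast, ← zpow_mul, mul_comm, zpow_mul]; norm_num
    rw [pow_succ, this, one_mul]
  rw [toFr_T, toFr_τ, mul_pow, mul_assoc, ← zpow_add₀ q_ne_zero, ← h, ← h',
    ← zpow_natCast (q ^ _), ← zpow_mul, mul_comm (3 : ℤ)]
  rfl

lemma toFr_T_neg (n : ℤ) : toFr (T (-n)) = q ^ (-n) * toFr (T n) := by
  have h1 := toFr_T_mul (-n)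
  have h2 := toFr_T_mul n
  have := zpow_ne_zero n q_ne_zero
  rw [toFr_τ_neg, mul_pow, ← h2, zpow_neg] at h1
  rw [zpow_neg]
  field_simp at h1 ⊢
  linear_combination h1

lemma Θ_τ (n : ℤ) : Θ (τ n) = 3 * n * (n + 1) * τ n := by
  have h : Θ (τ n) = ((n * (n + 1) / 2).toNat : A) * τ n := by
    rw [τ, Θ_mul, Θ_X_pow]
    have : Θ ((-1 : A) ^ n.natAbs) = 0 := by exact_mod_cast Θ_intCast ((-1) ^ n.natAbs)
    rw [this]; ring
  have h2 : 2 * ((n * (n + 1) / 2).toNat : A) = n * (n + 1) := by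
    have := two_mul_triangle n
    rw [← Int.toNat_of_nonneg (triangle_nonneg n)] at this
    exact_mod_cast congrArg (Int.cast (R := A)) this
  rw [h]
  linear_combination 3 * τ n * h2 - ((n * (n + 1) / 2).toNat : A) * τ n * five_eq_zero

lemma Θ_T (n : ℤ) : Θ (T n) = 3 * n * (3 * n + 1) * T n := by
  have h : Θ (T n) = ((n * (3 * n + 1) / 2).toNat : A) * T n := by
    rw [T, Θ_mul, Θ_X_pow]
    have : Θ ((-1 : A) ^ n.natAbs) = 0 := by exact_mod_cast Θ_intCast ((-1) ^ n.natAbs)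
    rw [this]; ring
  have h2 : 2 * ((n * (3 * n + 1) / 2).toNat : A) = n * (3 * n + 1) := by
    have := two_mul_pentagon n
    rw [← Int.toNat_of_nonneg (pentagon_nonneg n)] at this
    exact_mod_cast congrArg (Int.cast (R := A)) this
  rw [h]
  linear_combination 3 * T n * h2 - ((n * (3 * n + 1) / 2).toNat : A) * T n * five_eq_zero

/-! ### Theta-weighted sums -/

lemma eq_zero_of_eq_neg {a : A} (h : a = -a) : a = 0 := by
  linear_combination 3 * h - a * five_eq_zero

lemma tsum_reflect (f : ℤ → A) : ∑' n, f (-1 - n) = ∑' n, f n :=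
  (Equiv.subLeft (-1 : ℤ)).tsum_eq f

lemma tsum_comp_neg (f : ℤ → A) : ∑' n, f (-n) = ∑' n, f n :=
  (Equiv.neg ℤ).tsum_eq f

lemma tsum_comp_add (f : ℤ → A) (k : ℤ) : ∑' n, f (n + k) = ∑' n, f n :=
  (Equiv.addRight k).tsum_eq f

lemma tsum_eq_zero_of_reflect {f : ℤ → A} (h : ∀ n, f (-1 - n) = -f n) : ∑' n, f n = 0 := by
  refine eq_zero_of_eq_neg ?_
  conv_lhs => rw [← tsum_reflect f]
  rw [← tsum_neg]
  exact tsum_congr h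

lemma tsum_eq_zero_of_neg {f : ℤ → A} (h : ∀ n, f (-n) = -f n) : ∑' n, f n = 0 := by
  refine eq_zero_of_eq_neg ?_
  conv_lhs => rw [← tsum_comp_neg f]
  rw [← tsum_neg]
  exact tsum_congr h

lemma tsum_τ : ∑' n, τ n = 0 := tsum_eq_zero_of_reflect τ_reflect

/-- The partial fraction sum `∑ τ m d (m - n)`. -/
noncomputable def W (n : ℤ) : A := ∑' m, τ m * d (m - n)

/-- The partial fraction sum `∑ τ m d (m - n) d (n - m)`. -/
noncomputable def V (n : ℤ) : A := ∑' m, τ m * (d (m - n) * d (n - m))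

lemma e_eq_add_ite (n : ℤ) : e n = d n - 1 + if n = 0 then 1 else 0 := by
  split_ifs with h
  · simp [h]
  · rw [e_eq h]; ring

lemma τ_neg_mul_d (n : ℤ) : τ (-n) * d (-n) = -(τ n * d n) := by
  apply toFr_injective
  rw [d_neg, map_mul, toFr_τ_neg, map_neg, map_neg, toFr_e, map_mul, toFr_d, zpow_neg]
  have := zpow_ne_zero n q_ne_zero
  field_simp

lemma τ_add_one_mul_d (n : ℕ) (m : ℤ) :
    τ (m + 1) * d (m - n) = -(X ^ (n + 1) * (τ m * e (m - n))) := by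
  apply toFr_injective
  have h : q ^ (m + 1) = q ^ (n + 1) * q ^ (m - n) := by
    rw [← zpow_natCast, ← zpow_add₀ q_ne_zero]; congr 1; push_cast; ring
  rw [map_neg, map_mul, map_mul, map_mul, toFr_τ_add_one, h, toFr_e, toFr_d, map_pow, toFr_X]
  ring

lemma ite_sub_eq_zero (m n : ℤ) (a : A) :
    (a * if m - n = 0 then 1 else 0) = if m = n then a else 0 := by
  simp [sub_eq_zero]

lemma W_zero : W 0 = 0 :=
  tsum_eq_zero_of_neg fun n => by simpa using τ_neg_mul_d n

lemma hasSum_W (n : ℤ) : HasSum (fun m => τ m * d (m - n)) (W n) :=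
  (τ_small.mul_right _).summable.hasSum

lemma hasSum_V (n : ℤ) : HasSum (fun m => τ m * (d (m - n) * d (n - m))) (V n) :=
  (τ_small.mul_right _).summable.hasSum

lemma hasSum_τ : HasSum τ 0 := tsum_τ ▸ τ_small.summable.hasSum

lemma hasSum_ite_τ (n : ℤ) : HasSum (fun m => if m = n then τ m else 0) (τ n) := by
  convert hasSum_ite_eq n (τ n) using 3 with m h
  rw [h]

lemma W_add_one (n : ℕ) : W (n + 1) = -(X ^ (n + 1) * (W n + τ n)) := by
  have h := ((((hasSum_W n).sub hasSum_τ).add (hasSum_ite_τ n)).mul_left (X ^ (n + 1) : A)).neg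
  rw [sub_zero] at h
  rw [← h.tsum_eq, W, ← tsum_comp_add _ 1]
  refine tsum_congr fun m => ?_
  rw [add_sub_add_right_eq_sub, τ_add_one_mul_d, e_eq_add_ite, ← ite_sub_eq_zero m n]
  ring

lemma V_add_one (n : ℕ) : V (n + 1) = -(X ^ (n + 1) * (V n + W n + τ n)) := by
  have h := (((((hasSum_V n).add (hasSum_W n)).sub hasSum_τ).add
    (hasSum_ite_τ n)).mul_left (X ^ (n + 1) : A)).neg
  rw [sub_zero] at h
  rw [← h.tsum_eq, V, ← tsum_comp_add _ 1]
  refine tsum_congr fun m => ?_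
  have h1 : e (m - n) * d (n - m) = d (m - n) * d (n - m) + e (m - n) := by
    have := d_mul_e (n - m)
    rw [← neg_sub m (n : ℤ), e_neg, d_neg] at this
    rw [← neg_sub m (n : ℤ), d_neg]
    linear_combination this
  rw [add_sub_add_right_eq_sub, add_sub_add_right_eq_sub, ← mul_assoc, τ_add_one_mul_d,
    ← ite_sub_eq_zero m n]
  linear_combination -(X : A) ^ (n + 1) * τ m * (h1 + e_eq_add_ite (m - n))

lemma W_reflect (n : ℤ) : W (-1 - n) = τ n + W n := by
  have h := ((hasSum_W n).sub hasSum_τ).add (hasSum_ite_τ n)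
  rw [sub_zero] at h
  rw [add_comm, ← h.tsum_eq, W, ← tsum_reflect]
  refine tsum_congr fun m => ?_
  have h2 := d_neg (m - n)
  rw [show -1 - m - (-1 - n) = -(m - n) by ring, τ_reflect, h2, e_eq_add_ite,
    ← ite_sub_eq_zero m n]
  ring

lemma V_reflect (n : ℤ) : V (-1 - n) = -V n := by
  rw [V, ← tsum_reflect, V, ← tsum_neg]
  refine tsum_congr fun m => ?_
  rw [show -1 - m - (-1 - n) = n - m by ring, show -1 - n - (-1 - m) = m - n by ring, τ_reflect]
  ring

lemma τ_add_one (n : ℕ) : τ (n + 1) = -(X ^ (n + 1) * τ n) := by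
  apply toFr_injective
  rw [toFr_τ_add_one, map_neg, map_mul, map_pow, toFr_X, ← zpow_natCast]
  push_cast
  rfl

/-- A statement about integers follows from its natural case and the symmetry `n ↦ -1 - n`. -/
lemma int_reflect_induction {p : ℤ → Prop} (h : ∀ n : ℕ, p n)
    (h' : ∀ n : ℕ, p n → p (-1 - n)) (n : ℤ) : p n := by
  cases n with
  | ofNat n => exact h n
  | negSucc n =>
    rw [show Int.negSucc n = -1 - (n : ℤ) by omega]
    exact h' n (h n)

lemma W_eq (n : ℤ) : W n = n * τ n := by
  induction n using int_reflect_induction with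
  | h n =>
    induction n with
    | zero => simpa using W_zero
    | succ n ih =>
      push_cast at ih ⊢
      rw [W_add_one, ih, τ_add_one]
      ring
  | h' n ih =>
    rw [W_reflect, ih, τ_reflect]
    push_cast
    ring

lemma V_eq (n : ℤ) : V n = τ n * (V 0 + 3 * n * (n + 1)) := by
  induction n using int_reflect_induction with
  | h n =>
    induction n with
    | zero => simp
    | succ n ih =>
      have h := W_eq n
      push_cast at ih h ⊢
      rw [V_add_one, ih, h, τ_add_one]
      linear_combination (n + 1) * (X : A) ^ (n + 1) * τ n * five_eq_zero
  | h' n ih =>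
    rw [V_reflect, ih, τ_reflect]
    push_cast
    ring

/-- `G k = ∑ T n e n ^ k`. -/
noncomputable def G (k : ℕ) : A := ∑' n, T n * e n ^ k

lemma Θ_T_mul_e_pow (n : ℤ) (k : ℕ) : Θ (T n * e n ^ k)
    = 3 * n * (3 * n + 1) * (T n * e n ^ k) + k * n * (T n * (d n * e n ^ k)) := by
  have h1 : Θ (e n) = n * (d n * e n) := by
    rw [e, map_neg, Θ_d, e_neg, d_neg]
    push_cast
    rw [e]; ring
  rw [Θ_mul, Θ_T, Derivation.leibniz_pow, h1]
  cases k with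
  | zero => simp
  | succ k =>
    simp only [smul_eq_mul, nsmul_eq_mul, Nat.add_sub_cancel, pow_succ]
    push_cast
    ring

/-- The sum of `T n` over `n ≠ 0`. -/
noncomputable def σ₀ : A := ∑' n, T n - 1

/-- `R = ∑ T n d n e n`. -/
noncomputable def R : A := ∑' n, T n * (d n * e n)

/-- `H = ∑ T n (d n e n) ^ 2`. -/
noncomputable def H : A := ∑' n, T n * (d n ^ 2 * e n ^ 2)

lemma T_neg_mul_d (n : ℤ) : T (-n) * d (-n) = -(T n * d n) := by
  apply toFr_injective
  rw [d_neg, map_mul, toFr_T_neg, map_neg, map_neg, toFr_e, map_mul, toFr_d, zpow_neg]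
  have := zpow_ne_zero n q_ne_zero
  field_simp

lemma tsum_T_mul_d : ∑' n, T n * d n = 0 := tsum_eq_zero_of_neg T_neg_mul_d

lemma tsum_T_mul_d_sq_mul_e : ∑' n, T n * (d n ^ 2 * e n) = 0 :=
  tsum_eq_zero_of_neg fun n => by
    have := T_neg_mul_d n
    rw [e_neg, d_neg] at *
    linear_combination e n * d n * this

lemma hasSum_T_mul (f : ℤ → A) : HasSum (fun n => T n * f n) (∑' n, T n * f n) :=
  (T_small.mul_right f).summable.hasSum

lemma G_one : G 1 = -σ₀ := by
  have h1 : HasSum (fun n : ℤ => if n = 0 then (1 : A) else 0) 1 := hasSum_ite_eq 0 1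
  have h := ((hasSum_T_mul d).sub T_small.summable.hasSum).add h1
  rw [tsum_T_mul_d] at h
  rw [show -σ₀ = 0 - ∑' n, T n + 1 by rw [σ₀]; ring, G, ← h.tsum_eq]
  refine tsum_congr fun n => ?_
  rw [pow_one, e_eq_add_ite]
  split_ifs with hn
  · simp [hn]
  · ring

lemma G_two : G 2 = R + σ₀ := by
  have h := (hasSum_T_mul fun n => d n * e n).sub (hasSum_T_mul fun n => e n ^ 1)
  rw [show R + σ₀ = R - G 1 by rw [G_one]; ring, R, G, G, ← h.tsum_eq]
  refine tsum_congr fun n => ?_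
  linear_combination -T n * e_mul_d n

lemma G_three : G 3 = -2 * R - σ₀ := by
  have h1 : ∑' n, T n * (d n * e n ^ 2) = -R := by
    have h := (hasSum_T_mul fun n => d n ^ 2 * e n).sub (hasSum_T_mul fun n => d n * e n)
    rw [tsum_T_mul_d_sq_mul_e, zero_sub] at h
    rw [R, ← h.tsum_eq]
    refine tsum_congr fun n => ?_
    linear_combination -T n * d n * e_mul_d n
  have h := (hasSum_T_mul fun n => d n * e n ^ 2).sub (hasSum_T_mul fun n => e n ^ 2)
  rw [h1] at h
  change HasSum _ (-R - G 2) at h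
  rw [G_two] at h
  rw [show -2 * R - σ₀ = -R - (R + σ₀) by ring, G, ← h.tsum_eq]
  refine tsum_congr fun n => ?_
  linear_combination -T n * e n * e_mul_d n

lemma G_four : G 4 = H + 3 * R + σ₀ := by
  have h := ((hasSum_T_mul fun n => d n ^ 2 * e n ^ 2).sub
    ((hasSum_T_mul fun n => e n ^ 3).mul_left 2)).sub (hasSum_T_mul fun n => e n ^ 2)
  change HasSum _ (H - 2 * G 3 - G 2) at h
  rw [G_two, G_three] at h
  rw [show H + 3 * R + σ₀ = H - 2 * (-2 * R - σ₀) - (R + σ₀) by ring, G, ← h.tsum_eq]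
  refine tsum_congr fun n => ?_
  linear_combination -T n * (e n * d n + e n * (e n + 1)) * e_mul_d n

/-! ### Squares and cubes of partial fraction sums -/

lemma sum_sq_of_partial_fractions {ι B : Type*} [DecidableEq ι] [CommRing B] (I : Finset ι)
    (t g : ι → B) (D : ι → ι → B) (c : B) (hD : ∀ n, D n n = 0)
    (h : ∀ n ∈ I, ∀ m ∈ I, n ≠ m → g n * g m = c * (D n m * g n + D m n * g m)) :
    (∑ n ∈ I, t n * g n) ^ 2 = ∑ n ∈ I, t n ^ 2 * g n ^ 2
      + 2 * c * ∑ n ∈ I, t n * (∑ m ∈ I, t m * D n m) * g n := by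
  have h1 : (∑ n ∈ I, t n * g n) ^ 2 = ∑ n ∈ I, ∑ m ∈ I,
      ((if n = m then t n ^ 2 * g n ^ 2 else 0) + (t m * D n m) * (c * t n * g n)
        + (t n * D m n) * (c * t m * g m)) := by
    rw [sq, sum_mul_sum]
    refine sum_congr rfl fun n hn => sum_congr rfl fun m hm => ?_
    split_ifs with hnm
    · subst hnm; rw [hD]; ring
    · linear_combination t n * t m * h n hn m hm hnm
  have h2 : ∑ n ∈ I, ∑ m ∈ I, (t n * D m n) * (c * t m * g m)
      = ∑ n ∈ I, ∑ m ∈ I, (t m * D n m) * (c * t n * g n) := sum_comm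
  simp only [h1, sum_add_distrib, h2, ← sum_mul, mul_sum, sum_ite_eq]
  rw [add_assoc, ← sum_add_distrib, ← sum_add_distrib, ← sum_add_distrib]
  refine sum_congr rfl fun n hn => ?_
  rw [if_pos hn, ← mul_sum]
  ring

lemma sum_cube_of_partial_fractions {ι B : Type*} [DecidableEq ι] [CommRing B] (I : Finset ι)
    (t g : ι → B) (D : ι → ι → B) (c : B) (hD : ∀ n, D n n = 0)
    (h : ∀ n ∈ I, ∀ m ∈ I, n ≠ m → g n * g m = c * (D n m * g n + D m n * g m))
    (hDD : ∀ m n k, n ≠ m → k ≠ m → n ≠ k → D m n * D m k = D n k * D m n + D k n * D m k) :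
    (∑ n ∈ I, t n * g n) ^ 3 = ∑ n ∈ I, (t n ^ 3 * g n ^ 3
      + 3 * c * t n ^ 2 * (∑ m ∈ I, t m * D n m) * g n ^ 2
      + 3 * c ^ 2 * (t n * (∑ m ∈ I, t m * D n m) ^ 2
        + t n ^ 2 * ∑ m ∈ I, t m * (D n m * D m n)) * g n) := by
  set W := fun n => ∑ m ∈ I, t m * D n m with hW
  set V := fun n => ∑ m ∈ I, t m * (D n m * D m n) with hV
  have hQ : ∀ m ∈ I, ∑ n ∈ I, (t n ^ 2 * D m n ^ 2 + 2 * t n * W n * D m n)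
      = W m ^ 2 + 2 * t m * V m := by
    intro m hm
    have h1 := sum_sq_of_partial_fractions (I.erase m) t (fun n => D m n) D 1 hD
      (fun n hn k hk hnk => by
        rw [one_mul]; exact hDD m n k (ne_of_mem_erase hn) (ne_of_mem_erase hk) hnk)
    have e1 : ∀ f : ι → B, f m = 0 → ∑ n ∈ I.erase m, f n = ∑ n ∈ I, f n := fun f hf => by
      rw [← add_sum_erase I f hm, hf, zero_add]
    have e2 : ∀ n, ∑ k ∈ I.erase m, t k * D n k = W n - t m * D n m := fun n => by
      rw [hW]; simp only; rw [← add_sum_erase I _ hm]; ring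
    simp only [e2] at h1
    rw [e1 _ (by simp [hD]), e1 _ (by simp [hD]), hD] at h1
    have h3 : ∑ n ∈ I, t n * (W n - t m * D n m) * D m n
        = ∑ n ∈ I, t n * W n * D m n - t m * V m := by
      rw [hV, mul_sum, ← sum_sub_distrib]
      exact sum_congr rfl fun n _ => by ring
    rw [h3] at h1
    have h4 : ∑ n ∈ I, 2 * t n * W n * D m n = 2 * ∑ n ∈ I, t n * W n * D m n := by
      rw [mul_sum]
      exact sum_congr rfl fun n _ => by ring
    rw [sum_add_distrib, h4]
    linear_combination -h1
  have h2 := sum_sq_of_partial_fractions I t g D c hD h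
  have h1 : (∑ n ∈ I, t n * g n) ^ 3 = ∑ n ∈ I, ∑ m ∈ I,
      ((if n = m then t n ^ 3 * g n ^ 3 + 2 * c * t n ^ 2 * W n * g n ^ 2 else 0)
        + (t m * D n m) * (c * t n ^ 2 * g n ^ 2 + 2 * c ^ 2 * t n * W n * g n)
        + (t m * (D n m * D m n)) * (c ^ 2 * t n ^ 2 * g n)
        + (c ^ 2 * t m * g m) * (t n ^ 2 * D m n ^ 2 + 2 * t n * W n * D m n)) := by
    have h3 : (∑ n ∈ I, t n * g n) ^ 2
        = ∑ n ∈ I, (t n ^ 2 * g n ^ 2 + 2 * c * (t n * W n * g n)) := by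
      rw [h2, mul_sum, ← sum_add_distrib]
    rw [pow_succ, h3, sum_mul_sum]
    refine sum_congr rfl fun n hn => sum_congr rfl fun m hm => ?_
    split_ifs with hnm
    · subst hnm; simp only [hD]; ring
    · linear_combination (t n ^ 2 * g n * t m + 2 * c * t n * W n * t m
        + c * D m n * t n ^ 2 * t m) * h n hn m hm hnm
  have h5 : ∑ n ∈ I, ∑ m ∈ I, (c ^ 2 * t m * g m) * (t n ^ 2 * D m n ^ 2 + 2 * t n * W n * D m n)
      = ∑ n ∈ I, (c ^ 2 * t n * g n) * (W n ^ 2 + 2 * t n * V n) := by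
    rw [sum_comm]
    refine sum_congr rfl fun m hm => ?_
    rw [← mul_sum, hQ m hm]
  rw [h1]
  simp only [sum_add_distrib]
  rw [h5]
  simp only [← sum_mul, sum_ite_eq, ← sum_add_distrib]
  refine sum_congr rfl fun n hn => ?_
  rw [if_pos hn]
  change _ + W n * _ + V n * _ + _ = _
  ring

/-! ### The cube of the reciprocal theta series -/

/-- The expansion of `1 / (1 - (1 + s) q ^ n)` in powers of `s`, for `n ≠ 0`. -/
noncomputable def h (n : ℤ) : PowerSeries A := mk fun j => d n * e n ^ j

/-- The expansion of `-s / (1 - (1 + s) q ^ n)` in powers of `s`. -/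
noncomputable def g (n : ℤ) : PowerSeries A := (if n = 0 then 1 else 0) - X * h n

@[simp] lemma h_zero : h 0 = 0 := by ext j; simp [h]

@[simp] lemma g_zero : g 0 = 1 := by simp [g]

lemma g_of_ne_zero {n : ℤ} (hn : n ≠ 0) : g n = -(X * h n) := by simp [g, hn]

lemma h_mul (n : ℤ) : h n * (1 - X * C (e n)) = C (d n) := by
  ext1 j
  rw [mul_sub, mul_one, ← mul_assoc, mul_comm (h n) X, mul_assoc, map_sub]
  cases j with
  | zero => simp [h]
  | succ j =>
    rw [coeff_succ_X_mul, coeff_mul_C, h, coeff_mk, coeff_mk, coeff_C, if_neg (by omega)]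
    ring

lemma one_sub_X_mul_C_ne_zero (a : A) : (1 - X * C a : PowerSeries A) ≠ 0 := fun h => by
  simpa using congrArg constantCoeff h

lemma h_eq (n : ℤ) : h n = C (d n) * rescale (e n) (mk 1) := by
  ext1 j
  simp [h, coeff_rescale]

lemma coeff_h_pow (n : ℤ) (k j : ℕ) :
    coeff j (h n ^ (k + 1)) = (k + j).choose k * (d n ^ (k + 1) * e n ^ j) := by
  rw [h_eq, mul_pow, ← map_pow, ← map_pow, mk_one_pow_eq_mk_choose_add, coeff_C_mul,
    coeff_rescale, coeff_mk]
  ring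

lemma h_mul_h {n m : ℤ} (hn : n ≠ 0) (hm : m ≠ 0) (hnm : n ≠ m) :
    h n * h m = C (d (m - n)) * h n + C (d (n - m)) * h m := by
  refine mul_right_cancel₀ (one_sub_X_mul_C_ne_zero (e n))
    (mul_right_cancel₀ (one_sub_X_mul_C_ne_zero (e m)) ?_)
  have h1 := congrArg (C (R := A)) (d_mul_d hn hm hnm)
  have h2 := congrArg (C (R := A)) (d_add_d_neg (sub_ne_zero.2 hnm))
  have h3 := congrArg (C (R := A)) (e_eq hn)
  have h4 := congrArg (C (R := A)) (e_eq hm)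
  have h5 := h_mul n
  have h6 := h_mul m
  rw [neg_sub] at h2
  simp only [map_mul, map_add, map_one, map_sub] at h1 h2 h3 h4
  linear_combination (exp := 1) (h m * (1 - X * C (e m)) - C (d (m - n)) * (1 - X * C (e m))) * h5
    + (C (d n) - C (d (n - m)) * (1 - X * C (e n))) * h6 + h1
    + X * (C (d (m - n)) * C (d n) * h4 + C (d (n - m)) * C (d m) * h3)
    + X * (C (d n) * C (d m) * h2 + h1)

lemma g_mul_g {n m : ℤ} (hnm : n ≠ m) :
    g n * g m = -X * (C (d (m - n)) * g n + C (d (n - m)) * g m) := by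
  have key : ∀ k : ℤ, k ≠ 0 → g k = -X * (C (d k) + C (d (-k)) * g k) := fun k hk => by
    rw [g_of_ne_zero hk, d_neg, map_neg]
    linear_combination -X * h_mul k
  rcases eq_or_ne n 0 with rfl | hn
  · rw [g_zero, one_mul, mul_one, sub_zero, zero_sub]
    exact key m hnm.symm
  rcases eq_or_ne m 0 with rfl | hm
  · rw [g_zero, mul_one, mul_one, sub_zero, zero_sub, add_comm]
    exact key n hn
  rw [g_of_ne_zero hn, g_of_ne_zero hm]
  linear_combination X ^ 2 * h_mul_h hn hm hnm

lemma coeff_g (n : ℤ) (j : ℕ) : coeff (j + 1) (g n) = -(d n * e n ^ j) := by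
  rw [g, map_sub, coeff_succ_X_mul, h, coeff_mk]
  split_ifs <;> simp [coeff_one]

lemma coeff_zero_g (n : ℤ) : coeff 0 (g n) = if n = 0 then 1 else 0 := by
  rw [g]
  split_ifs <;> simp

lemma coeff_g_sq (n : ℤ) (j : ℕ) : coeff (j + 2) (g n ^ 2) = coeff j (h n ^ 2) := by
  rcases eq_or_ne n 0 with rfl | hn
  · simp [coeff_one]
  · rw [g_of_ne_zero hn, neg_sq, mul_pow, coeff_X_pow_mul]

lemma coeff_g_cube (n : ℤ) (j : ℕ) : coeff (j + 3) (g n ^ 3) = -coeff j (h n ^ 3) := by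
  rcases eq_or_ne n 0 with rfl | hn
  · simp [coeff_one]
  · rw [g_of_ne_zero hn, Odd.neg_pow (by decide), mul_pow, map_neg, coeff_X_pow_mul]

/-- The series `∑ τ n g n`, a multiple of the reciprocal of the theta series. -/
noncomputable def F : PowerSeries A := ∑' n, C (τ n) * g n

lemma C_dvd_of_forall_dvd_coeff {a : A} {p : PowerSeries A} (hp : ∀ k, a ∣ coeff k p) :
    C a ∣ p := by
  choose c hc using hp
  refine ⟨mk c, ?_⟩
  ext1 k
  rw [coeff_C_mul, coeff_mk, hc]

lemma dvd_coeff_of_C_dvd {a : A} {p : PowerSeries A} (hp : C a ∣ p) (k : ℕ) : a ∣ coeff k p := by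
  obtain ⟨c, rfl⟩ := hp
  rw [coeff_C_mul]
  exact dvd_mul_right _ _

lemma dvd_coeff_cube_sub (M k : ℕ) :
    X ^ M ∣ coeff k ((∑ n ∈ Icc (-(M : ℤ)) M, C (τ n) * g n) ^ 3) - coeff k (F ^ 3) := by
  rw [← map_sub]
  refine dvd_coeff_of_C_dvd (dvd_trans (C_dvd_of_forall_dvd_coeff fun i => ?_)
    (sub_dvd_pow_sub_pow _ _ 3)) k
  rw [map_sub, F, coeff_tsum_C_mul τ_small, map_sum]
  simp only [coeff_C_mul]
  exact (τ_small.mul_right _).dvd_sum_sub_tsum M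

lemma τ_cube_mul_d (n : ℤ) : τ n ^ 3 * d n = T n * e n := by
  apply toFr_injective
  rw [map_mul, map_mul, map_pow, ← toFr_T_mul, toFr_d, toFr_e]
  ring

/-- A summand of the cubed partial fraction expansion. -/
noncomputable def cubeTerm (j : ℕ) (n : ℤ) (w v : A) : A :=
  (2 + j).choose 2 * (τ n ^ 3 * (d n ^ 3 * e n ^ j))
    + 3 * τ n ^ 2 * w * ((1 + j).choose 1 * (d n ^ 2 * e n ^ j))
    + 3 * (τ n * w ^ 2 + τ n ^ 2 * v) * (d n * e n ^ j)

lemma coeff_sum_cube (I : Finset ℤ) (j : ℕ) :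
    coeff (j + 3) ((∑ n ∈ I, C (τ n) * g n) ^ 3) = -∑ n ∈ I, cubeTerm j n
      (∑ m ∈ I, τ m * d (m - n)) (∑ m ∈ I, τ m * (d (m - n) * d (n - m))) := by
  rw [sum_cube_of_partial_fractions I (fun n => C (τ n)) g (fun n m => C (d (m - n))) (-X)
    (by simp) (fun n _ m _ hnm => g_mul_g hnm), map_sum, ← sum_neg_distrib]
  · refine sum_congr rfl fun n _ => ?_
    simp only [← map_mul, ← map_sum, ← map_pow]
    set w := ∑ m ∈ I, τ m * d (m - n)
    set v := ∑ m ∈ I, τ m * (d (m - n) * d (n - m))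
    have h1 : 3 * -X * C (τ n ^ 2) * C w * g n ^ 2
        = X * (C (-(3 * τ n ^ 2 * w)) * g n ^ 2) := by
      simp only [map_neg, map_mul, map_ofNat]; ring
    have h2 : 3 * (-X) ^ 2 * (C (τ n * w ^ 2) + C (τ n ^ 2 * v)) * g n
        = X ^ 2 * (C (3 * (τ n * w ^ 2 + τ n ^ 2 * v)) * g n) := by
      simp only [map_add, map_mul, map_ofNat]; ring
    rw [h1, h2, map_add, map_add, coeff_C_mul, coeff_g_cube, coeff_succ_X_mul, coeff_C_mul,
      coeff_g_sq, show j + 3 = (j + 1) + 2 from rfl, coeff_X_pow_mul, coeff_C_mul, coeff_g,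
      coeff_h_pow, coeff_h_pow, cubeTerm]
    ring
  · intro m n k hnm hkm hnk
    have := d_mul_d (sub_ne_zero.2 hnm) (sub_ne_zero.2 hkm)
      (fun h => hnk (sub_left_injective h))
    rw [sub_sub_sub_cancel_right, sub_sub_sub_cancel_right] at this
    rw [← map_mul, this, map_add, map_mul, map_mul]

lemma dvd_cubeTerm_sub {a : A} (j : ℕ) (n : ℤ) {w w' v v' : A} (hw : a ∣ w - w')
    (hv : a ∣ v - v') : a ∣ cubeTerm j n w v - cubeTerm j n w' v' := by
  obtain ⟨x, hx⟩ := hw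
  obtain ⟨y, hy⟩ := hv
  refine ⟨3 * τ n ^ 2 * x * ((1 + j).choose 1 * (d n ^ 2 * e n ^ j))
    + 3 * (τ n * (x * (w + w')) + τ n ^ 2 * y) * (d n * e n ^ j), ?_⟩
  rw [cubeTerm, cubeTerm]
  linear_combination (3 * τ n ^ 2 * ((1 + j).choose 1 * (d n ^ 2 * e n ^ j))
    + 3 * τ n * (w + w') * (d n * e n ^ j)) * hx + 3 * τ n ^ 2 * (d n * e n ^ j) * hy

lemma cubeTerm_W_V (j : ℕ) (n : ℤ) : cubeTerm j n (W n) (V n)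
    = T n * ((2 + j).choose 2 * (d n ^ 2 * e n ^ (j + 1)))
      + 3 * Θ (T n * e n ^ (j + 1)) + 3 * V 0 * (T n * e n ^ (j + 1)) := by
  rw [Θ_T_mul_e_pow, cubeTerm, W_eq, V_eq, Nat.choose_one_right]
  push_cast
  linear_combination ((2 + j).choose 2 * (d n ^ 2 * e n ^ j) + 3 * n * (1 + j) * d n * e n ^ j
    + (12 * n ^ 2 + 9 * n + 3 * V 0) * e n ^ j) * τ_cube_mul_d n
    - 3 * n ^ 2 * T n * e n ^ (j + 1) * five_eq_zero

lemma neg_coeff_F_cube (j : ℕ) : -coeff (j + 3) (F ^ 3)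
    = (2 + j).choose 2 * ∑' n, T n * (d n ^ 2 * e n ^ (j + 1))
      + 3 * Θ (G (j + 1)) + 3 * V 0 * G (j + 1) := by
  have h1 : Small fun n => T n * e n ^ (j + 1) := T_small.mul_right _
  have h2 : Small fun n => Θ (T n * e n ^ (j + 1)) := fun n => by
    beta_reduce
    rw [Θ_T_mul_e_pow]
    have := T_small n
    exact dvd_add ((this.mul_right _).mul_left _) ((this.mul_right _).mul_left _)
  have h3 : Small fun n => cubeTerm j n (W n) (V n) := fun n => by
    beta_reduce
    rw [cubeTerm_W_V]
    exact dvd_add (dvd_add ((T_small n).mul_right _) ((h2 n).mul_left _))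
      (((T_small n).mul_right _).mul_left _)
  have h4 : -coeff (j + 3) (F ^ 3) = ∑' n, cubeTerm j n (W n) (V n) := by
    refine eq_of_forall_dvd_sub fun M => ?_
    have e1 := dvd_coeff_cube_sub M (j + 3)
    rw [coeff_sum_cube] at e1
    have e2 := h3.dvd_sum_sub_tsum M
    have e3 : X ^ M ∣ ∑ n ∈ Icc (-(M : ℤ)) M, (cubeTerm j n
        (∑ m ∈ Icc (-(M : ℤ)) M, τ m * d (m - n))
        (∑ m ∈ Icc (-(M : ℤ)) M, τ m * (d (m - n) * d (n - m))) - cubeTerm j n (W n) (V n)) :=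
      dvd_sum fun n _ => dvd_cubeTerm_sub j n ((τ_small.mul_right _).dvd_sum_sub_tsum M)
        ((τ_small.mul_right _).dvd_sum_sub_tsum M)
    rw [sum_sub_distrib] at e3
    convert dvd_add (dvd_add e1 e2) e3 using 1
    ring
  have h5 := (((hasSum_T_mul fun n => d n ^ 2 * e n ^ (j + 1)).mul_left
    ((2 + j).choose 2 : A)).add (h2.summable.hasSum.mul_left 3)).add
    (h1.summable.hasSum.mul_left (3 * V 0))
  rw [h4, G, Θ_tsum h1, ← h5.tsum_eq]
  refine tsum_congr fun n => ?_
  rw [cubeTerm_W_V]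
  ring

/-! ### Bailey-type identities -/

/-- The finite product `(1 - q) ⋯ (1 - q ^ n)`. -/
noncomputable def poch (n : ℕ) : A := ∏ i ∈ range n, (1 - X ^ (i + 1))

/-- The reciprocal of `(1 - q) ⋯ (1 - q ^ n)`, extended by zero to negative `n`. -/
noncomputable def qi : ℤ → A
  | Int.ofNat n => (poch n)⁻¹
  | Int.negSucc _ => 0

@[simp] lemma poch_zero : poch 0 = 1 := by simp [poch]

lemma poch_succ (n : ℕ) : poch (n + 1) = poch n * (1 - X ^ (n + 1)) := prod_range_succ _ _

lemma constantCoeff_poch (n : ℕ) : constantCoeff (poch n) = 1 := by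
  simp [poch, map_prod]

lemma poch_mul_qi (n : ℕ) : poch n * qi n = 1 :=
  PowerSeries.mul_inv_cancel _ (by simp [constantCoeff_poch])

lemma qi_of_neg {k : ℤ} (hk : k < 0) : qi k = 0 := by
  cases k with
  | ofNat n => simp at hk; omega
  | negSucc n => rfl

@[simp] lemma qi_zero : qi 0 = 1 := by simpa using poch_mul_qi 0

lemma qi_natCast_add_one (n : ℕ) : qi (n + 1) * (1 - X ^ (n + 1)) = qi n := by
  have h1 := poch_mul_qi n
  have h2 := poch_mul_qi (n + 1)
  rw [poch_succ] at h2
  push_cast at h2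
  linear_combination qi n * h2 - qi (n + 1) * (1 - X ^ (n + 1)) * h1

lemma toFr_qi_mul (k : ℤ) : toFr (qi k) * (1 - q ^ k) = toFr (qi (k - 1)) := by
  rcases lt_trichotomy k 0 with hk | rfl | hk
  · rw [qi_of_neg hk, qi_of_neg (by omega), map_zero, zero_mul]
  · rw [qi_of_neg (show (0 : ℤ) - 1 < 0 by norm_num)]; simp
  · obtain ⟨n, rfl⟩ : ∃ n : ℕ, k = n + 1 := ⟨(k - 1).toNat, by omega⟩
    have := congrArg toFr (qi_natCast_add_one n)
    rw [map_mul, map_sub, map_one, map_pow, toFr_X, ← zpow_natCast] at this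
    rw [add_sub_cancel_right, ← this]
    push_cast
    rfl

lemma dvd_poch_sub {m n : ℕ} (h : m ≤ n) : X ^ (m + 1) ∣ poch n - poch m := by
  induction n, h using Nat.le_induction with
  | base => simp
  | succ n hmn ih =>
    rw [poch_succ, show poch n * (1 - X ^ (n + 1)) - poch m
      = poch n - poch m - X ^ (n + 1) * poch n by ring]
    exact dvd_sub ih ((pow_dvd_pow _ (by omega)).mul_right _)

lemma dvd_poch_mul_qi_sub_one (M : ℕ) (k : ℤ) :
    X ^ (min (M : ℤ) k + 1).toNat ∣ poch M * qi k - 1 := by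
  rcases lt_or_ge k 0 with hk | hk
  · rw [Int.toNat_of_nonpos (by omega), pow_zero]
    exact one_dvd _
  lift k to ℕ using hk
  have h : poch M * qi k - 1 = (poch M - poch k) * qi k := by
    linear_combination poch_mul_qi k
  rw [h]
  refine dvd_mul_of_dvd_left ?_ _
  rcases le_total M k with hMk | hMk
  · rw [← neg_sub, dvd_neg, show (min (M : ℤ) k + 1).toNat = M + 1 by omega]
    exact dvd_poch_sub hMk
  · rw [show (min (M : ℤ) k + 1).toNat = k + 1 by omega]
    exact dvd_poch_sub hMk

/-- The Bailey weights `1 / ((q)_{M - n} (q)_{M + n})`. -/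
noncomputable def c (M : ℕ) (n : ℤ) : A := qi (M - n) * qi (M + n)

lemma c_neg (M : ℕ) (n : ℤ) : c M (-n) = c M n := by
  rw [c, c, sub_neg_eq_add, mul_comm]; rfl

lemma c_zero (n : ℤ) : c 0 n = if n = 0 then 1 else 0 := by
  rw [c, Nat.cast_zero, zero_sub, zero_add]
  split_ifs with h
  · simp [h]
  · rcases lt_or_gt_of_ne h with h | h
    · rw [qi_of_neg h, mul_zero]
    · rw [qi_of_neg (neg_neg_of_pos h), zero_mul]

lemma toFr_c_succ (M : ℕ) (n : ℤ) : toFr (c M n)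
    = (1 - q ^ (M + 1) * q ^ (-n)) * (1 - q ^ (M + 1) * q ^ n) * toFr (c (M + 1) n) := by
  have h1 := toFr_qi_mul (M + 1 - n)
  have h2 := toFr_qi_mul (M + 1 + n)
  rw [show (M : ℤ) + 1 - n - 1 = M - n by ring, show (M : ℤ) + 1 - n = (M + 1 : ℕ) + -n by
    push_cast; ring, zpow_add₀ q_ne_zero, zpow_natCast] at h1
  rw [show (M : ℤ) + 1 + n - 1 = M + n by ring, show (M : ℤ) + 1 + n = (M + 1 : ℕ) + n by
    push_cast; ring, zpow_add₀ q_ne_zero, zpow_natCast] at h2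
  rw [c, c, map_mul, map_mul, ← h1, ← h2]
  ring_nf

/-- The normalised Bailey weights, which tend to `1`. -/
noncomputable def u (M : ℕ) (n : ℤ) : A := poch M ^ 2 * c M n

lemma dvd_u_sub_one (M : ℕ) (n : ℤ) : X ^ (M + 1 - n.natAbs) ∣ u M n - 1 := by
  have h1 := dvd_poch_mul_qi_sub_one M (M - n)
  have h2 := dvd_poch_mul_qi_sub_one M (M + n)
  have h : u M n - 1 = (poch M * qi (M - n) - 1) * (poch M * qi (M + n))
      + (poch M * qi (M + n) - 1) := by rw [u, c]; ring
  rw [h]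
  exact dvd_add (((pow_dvd_pow _ (by omega)).trans h1).mul_right _)
    ((pow_dvd_pow _ (by omega)).trans h2)

lemma hasSum_τ_mul (f : ℤ → A) : HasSum (fun n => τ n * f n) (∑' n, τ n * f n) :=
  (τ_small.mul_right f).summable.hasSum

lemma one_sub_X_pow_mul_d (n : ℕ) : (1 - X ^ (n + 1) : A) * d (n + 1) = 1 :=
  PowerSeries.mul_inv_cancel _ (by simp)

lemma one_sub_X_pow_succ_ne_zero (M : ℕ) : (1 - X ^ (M + 1) : A) ≠ 0 := fun h => by
  simpa using congrArg constantCoeff h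

lemma tsum_τ_mul_c (M : ℕ) : ∑' n, τ n * c (M + 1) n = 0 := by
  have h0 : ∑' n, τ n * (qi (M - n) * qi (M + 1 + n)) = 0 := by
    refine tsum_eq_zero_of_reflect fun n => ?_
    rw [τ_reflect, show (M : ℤ) - (-1 - n) = M + 1 + n by ring,
      show (M : ℤ) + 1 + (-1 - n) = M - n by ring]
    ring
  have h1 : ∑' n, τ (-n) * c (M + 1) n = ∑' n, τ n * c (M + 1) n := by
    rw [← tsum_comp_neg fun n => τ n * c (M + 1) n]
    exact tsum_congr fun n => by rw [c_neg]
  have h2 : ∑' n, -(τ n * (qi (M - n) * qi (M + 1 + n)))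
      = ∑' n, (τ (-n) * c (M + 1) n - X ^ (M + 1) * (τ n * c (M + 1) n)) := by
    rw [← tsum_comp_add (fun n => τ (-n) * c (M + 1) n - X ^ (M + 1) * (τ n * c (M + 1) n)) 1]
    refine tsum_congr fun n => toFr_injective ?_
    have h3 := toFr_τ_neg (n + 1)
    have h4 := toFr_qi_mul (M + 1 + (n + 1))
    rw [show (M : ℤ) + 1 + (n + 1) = (M + 1 : ℕ) + (n + 1) by push_cast; ring,
      zpow_add₀ q_ne_zero, zpow_natCast] at h4
    rw [show ((M + 1 : ℕ) : ℤ) + (n + 1) - 1 = M + 1 + n by push_cast; ring] at h4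
    have h5 := τ_reflect n
    rw [show -1 - n = -(n + 1) by ring, ← neg_eq_iff_eq_neg] at h5
    rw [← h5, c, show ((M + 1 : ℕ) : ℤ) - (n + 1) = M - n by push_cast; ring]
    simp only [map_sub, map_mul, map_pow, toFr_X, map_neg, ← h4, h3, zpow_neg]
    have := zpow_ne_zero (n + 1) q_ne_zero
    field_simp
  rw [tsum_neg, h0, neg_zero] at h2
  have h3 : Small fun n => τ (-n) := fun n => by simpa using τ_small (-n)
  rw [Summable.tsum_sub (h3.mul_right _).summable
    ((hasSum_τ_mul _).summable.mul_left _), h1,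
    (hasSum_τ_mul _).summable.tsum_mul_left] at h2
  exact (mul_eq_zero.1 (show (1 - X ^ (M + 1) : A) * ∑' n, τ n * c (M + 1) n = 0 by
    linear_combination -h2)).resolve_left (one_sub_X_pow_succ_ne_zero M)

lemma tsum_T_mul_c (M : ℕ) : ∑' n, T n * c M n = qi M := by
  induction M with
  | zero => simp [c_zero]
  | succ M ih =>
    set a := ∑' n, T n * c (M + 1) n with ha
    have hT : Small fun n => T (-n) := fun n => by simpa using T_small (-n)
    have hτ : Small fun n => τ n ^ 3 := fun n => (τ_small n).trans (dvd_pow_self _ (by norm_num))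
    have h1 : HasSum (fun n => T (-n) * c (M + 1) n) a := by
      rw [ha, ← tsum_comp_neg fun n => T n * c (M + 1) n]
      simp only [c_neg]
      exact (hT.mul_right _).summable.hasSum
    have h2 : HasSum (fun n => τ n ^ 3 * (qi (M - n) * qi (M + 1 + n))) 0 := by
      have h := (hτ.mul_right fun n => qi (M - n) * qi (M + 1 + n)).summable.hasSum
      rwa [tsum_eq_zero_of_reflect fun n => ?_] at h
      rw [τ_reflect, show (M : ℤ) - (-1 - n) = M + 1 + n by ring,
        show (M : ℤ) + 1 + (-1 - n) = M - n by ring]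
      ring
    have h3 := ((hasSum_T_mul (c (M + 1))).sub (h1.mul_left (X ^ (M + 1) : A))).sub
      (h2.mul_left (X ^ (M + 1) : A))
    have h4 : a - X ^ (M + 1) * a = qi M := by
      rw [← ih, ← ha, mul_zero, sub_zero] at *
      rw [← h3.tsum_eq]
      refine tsum_congr fun n => toFr_injective ?_
      have e1 := toFr_T_neg n
      have e2 := toFr_T_mul n
      have e3 := toFr_qi_mul (M + 1 - n)
      rw [show (M : ℤ) + 1 - n - 1 = M - n by ring, show (M : ℤ) + 1 - n = (M + 1 : ℕ) + -n by
        push_cast; ring, zpow_add₀ q_ne_zero, zpow_natCast] at e3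
      simp only [map_sub, map_mul, map_pow, toFr_X, toFr_c_succ M n, e1, ← e2, ← e3]
      rw [c, show ((M + 1 : ℕ) : ℤ) - n = (M + 1 : ℕ) + -n by ring, map_mul, zpow_neg,
        show (M : ℤ) + 1 + n = (M + 1 : ℕ) + n by push_cast; ring]
      have := zpow_ne_zero n q_ne_zero
      field_simp
    have h5 := qi_natCast_add_one M
    push_cast
    refine mul_right_cancel₀ (one_sub_X_pow_succ_ne_zero M) ?_
    linear_combination h4 - h5

/-- The partial sums of `∑ q ^ n / (1 - q ^ n) ^ 2`. -/
noncomputable def Φ (N : ℕ) : A := ∑ n ∈ range N, X ^ (n + 1) * d (n + 1) ^ 2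

lemma u_zero {r : ℤ} (hr : r ≠ 0) : u 0 r = 0 := by simp [u, c_zero, hr]

lemma u_succ_sub {r : ℤ} (hr : r ≠ 0) (N : ℕ) :
    poch N ^ 2 * X ^ (N + 1) * c (N + 1) r = d r * e r * (u (N + 1) r - u N r) := by
  apply toFr_injective
  have h := one_sub_q_zpow_ne_zero hr
  have h2 := zpow_ne_zero r q_ne_zero
  simp only [map_mul, map_sub, map_pow, toFr_X, toFr_d, toFr_e, u, poch_succ, map_one,
    toFr_c_succ N, zpow_neg]
  field_simp
  ring

lemma sum_poch_sq_mul_c (N : ℕ) (r : ℤ) :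
    ∑ n ∈ range N, poch n ^ 2 * X ^ (n + 1) * c (n + 1) r
      = d r * e r * u N r + if r = 0 then Φ N else 0 := by
  split_ifs with hr
  · rw [hr, d_zero, zero_mul, zero_mul, zero_add, Φ]
    refine sum_congr rfl fun n _ => ?_
    have h1 := qi_natCast_add_one n
    have h2 := poch_mul_qi n
    have h3 := one_sub_X_pow_mul_d n
    rw [c, sub_zero, add_zero]
    push_cast
    have h4 : poch n * qi (n + 1) = d (n + 1) := by
      linear_combination (-poch n * qi (n + 1)) * h3 + d (n + 1) * (poch n * h1 + h2)
    rw [← h4]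
    ring
  · rw [add_zero, sum_congr rfl fun n _ => u_succ_sub hr n, ← mul_sum, sum_range_sub fun n => u n r,
      u_zero hr, sub_zero]

lemma sum_weighted {f : ℤ → A} (hf : Small f) (h0 : f 0 = 1) (N : ℕ) :
    ∑ n ∈ range N, poch n ^ 2 * X ^ (n + 1) * ∑' r, f r * c (n + 1) r
      = ∑' r, f r * (d r * e r) * u N r + Φ N := by
  have h1 := hasSum_sum (s := range N) fun n _ =>
    ((hf.mul_right (c (n + 1))).summable.hasSum.mul_left (poch n ^ 2 * X ^ (n + 1)))
  have h2 := (((hf.mul_right fun r => d r * e r).mul_right (u N)).summable.hasSum).add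
    (hasSum_ite_eq (0 : ℤ) (Φ N))
  rw [← h1.tsum_eq, ← h2.tsum_eq]
  refine tsum_congr fun r => ?_
  have h3 : (f r * if r = 0 then Φ N else 0) = if r = 0 then Φ N else 0 := by
    split_ifs with hr
    · rw [hr, h0, one_mul]
    · rw [mul_zero]
  have h4 := congrArg (f r * ·) (sum_poch_sq_mul_c N r)
  simp only [mul_add, h3, mul_sum] at h4
  rw [mul_assoc, ← h4]
  exact sum_congr rfl fun n _ => by ring

lemma tsum_τ_mul_d_mul_e : ∑' n, τ n * (d n * e n) = -V 0 := by
  rw [V, ← tsum_neg]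
  refine tsum_congr fun n => ?_
  rw [sub_zero, zero_sub, d_neg]
  ring

lemma dvd_Φ_sub (N : ℕ) : X ^ N ∣ Φ N - V 0 := by
  have h := sum_weighted τ_small τ_zero N
  simp only [tsum_τ_mul_c, mul_zero, sum_const_zero] at h
  have h2 := dvd_tsum_mul_sub (τ_small.mul_right fun r => d r * e r) (dvd_u_sub_one N)
  rw [tsum_τ_mul_d_mul_e] at h2
  rw [← dvd_neg]
  convert h2 using 1
  linear_combination h

/-- The smallest-parts series divided by the partition series. -/
lemma dvd_sum_poch_sub (N : ℕ) :
    X ^ N ∣ ∑ n ∈ range N, X ^ (n + 1) * (poch n * d (n + 1)) - (V 0 + R) := by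
  have h := sum_weighted T_small T_zero N
  have h1 : ∀ n, poch n ^ 2 * X ^ (n + 1) * ∑' r, T r * c (n + 1) r
      = X ^ (n + 1) * (poch n * d (n + 1)) := fun n => by
    have h1 := qi_natCast_add_one n
    have h2 := poch_mul_qi n
    have h3 := one_sub_X_pow_mul_d n
    rw [tsum_T_mul_c]
    push_cast
    linear_combination X ^ (n + 1) * (-poch n ^ 2 * qi (n + 1) * h3
      + d (n + 1) * poch n ^ 2 * h1 + poch n * d (n + 1) * h2)
  rw [sum_congr rfl fun n _ => h1 n] at h
  have h2 := dvd_tsum_mul_sub (T_small.mul_right fun r => d r * e r) (dvd_u_sub_one N)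
  rw [h]
  convert dvd_add h2 (dvd_Φ_sub N) using 1
  rw [R]
  ring

/-- Euler's pentagonal number theorem. -/
lemma dvd_poch_sub_tsum_T (N : ℕ) : X ^ N ∣ poch N - ∑' n, T n := by
  have h := dvd_tsum_mul_sub T_small (dvd_u_sub_one N)
  have h1 : ∑' n, T n * u N n = poch N := by
    have h2 := ((hasSum_T_mul (c N)).mul_left (poch N ^ 2)).tsum_eq
    rw [tsum_T_mul_c] at h2
    rw [show poch N = poch N ^ 2 * qi N by linear_combination -poch N * poch_mul_qi N, ← h2]
    exact tsum_congr fun n => by rw [u]; ring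
  rwa [h1] at h

/-! ### The theta series -/

/-- The power `(1 + s) ^ n` for an integer `n`. -/
noncomputable def Z (n : ℤ) : PowerSeries A := binomialSeries A n

lemma Z_zero : Z 0 = 1 := binomialSeries_zero

lemma Z_add (m n : ℤ) : Z (m + n) = Z m * Z n := binomialSeries_add m n

lemma Z_one : Z 1 = 1 + X := by
  have h := binomialSeries_nat (R := ℤ) (A := A) 1
  rwa [Nat.cast_one, pow_one] at h

lemma one_add_X_mul_Z_neg_one : (1 + X) * Z (-1) = 1 := by
  rw [← Z_one, ← Z_add, ← Z_zero]; rfl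

/-- The inclusion of `A⟦s⟧` in its fraction field. -/
noncomputable def incl : PowerSeries A →+* Fr := algebraMap _ _

lemma incl_injective : Function.Injective incl := IsFractionRing.injective (PowerSeries A) Fr

@[simp] lemma incl_C (a : A) : incl (C a) = toFr a := rfl

lemma incl_g_mul (n : ℤ) : incl (g n) * (1 - incl (1 + X) * q ^ n) = -incl X := by
  rcases eq_or_ne n 0 with rfl | hn
  · simp
  · have h1 := congrArg incl (h_mul n)
    have h2 := one_sub_q_zpow_ne_zero hn
    rw [g_of_ne_zero hn]
    simp only [map_mul, map_sub, map_one, incl_C, toFr_d, toFr_e, map_neg, map_add] at h1 ⊢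
    field_simp at h1
    linear_combination -incl X * h1

lemma g_recursion (M : ℕ) (n : ℤ) :
    (1 - (1 + X) * C (X ^ (M + 1))) * (1 - C (X ^ (M + 1)) * Z (-1)) * (C (τ n * c (M + 1) n) * g n)
      = C (τ n * c M n) * g n - X * C (X ^ (M + 1))
        * (C (τ (-n) * c (M + 1) n) - Z (-1) * C (τ n * c (M + 1) n)) := by
  apply incl_injective
  have h1 := incl_g_mul n
  have h2 := congrArg incl one_add_X_mul_Z_neg_one
  have h3 := zpow_ne_zero n q_ne_zero
  simp only [map_mul, map_sub, map_one, incl_C, map_pow, toFr_X, toFr_c_succ M n,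
    toFr_τ_neg, zpow_neg] at h1 h2 ⊢
  set z := incl (1 + X)
  set Y := incl (Z (-1))
  set x := q ^ (M + 1)
  set G := incl (g n)
  set S := incl X
  set y := q ^ n
  set t := toFr (τ n)
  set C := toFr (c (M + 1) n)
  field_simp
  linear_combination (exp := 1) t * C * x * (1 - Y * y) * h1 + t * C * x * (x - y) * G * y * h2

/-- The finite approximations to `F`. -/
noncomputable def Ffin (M : ℕ) : PowerSeries A := ∑' n, C (τ n * c M n) * g n

lemma hasSum_C_mul {f : ℤ → A} (hf : Small f) (k : ℤ → PowerSeries A) :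
    HasSum (fun n => C (f n) * k n) (∑' n, C (f n) * k n) :=
  (hf.summable_C_mul k).hasSum

lemma hasSum_C {f : ℤ → A} (hf : Small f) : HasSum (fun n => C (f n)) (C (∑' n, f n)) := by
  have h := hasSum_C_mul hf fun _ => 1
  simp only [mul_one] at h
  convert h using 1
  ext1 k
  have h2 := coeff_tsum_C_mul hf (fun _ => 1) k
  simp only [mul_one] at h2
  rw [h2, coeff_C, coeff_one]
  split_ifs
  · simp
  · simp

lemma Ffin_zero : Ffin 0 = 1 := by
  rw [Ffin, tsum_eq_single 0 fun n hn => by simp [c_zero, hn]]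
  simp [c_zero]

lemma Ffin_succ (M : ℕ) :
    (1 - (1 + X) * C (X ^ (M + 1))) * (1 - C (X ^ (M + 1)) * Z (-1)) * Ffin (M + 1) = Ffin M := by
  have hτ : Small fun n => τ (-n) := fun n => by simpa using τ_small (-n)
  have h1 : HasSum (fun n => C (τ n * c (M + 1) n)) (0 : PowerSeries A) := by
    have := hasSum_C (τ_small.mul_right (c (M + 1)))
    rwa [tsum_τ_mul_c, map_zero] at this
  have h2 : HasSum (fun n => C (τ (-n) * c (M + 1) n)) (0 : PowerSeries A) := by
    have := hasSum_C (hτ.mul_right (c (M + 1)))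
    rw [← tsum_comp_neg] at this
    simp only [neg_neg, c_neg] at this
    rwa [tsum_τ_mul_c, map_zero] at this
  have h3 := (hasSum_C_mul (τ_small.mul_right (c M)) g).sub
    ((h2.sub (h1.mul_left (Z (-1)))).mul_left (X * C (X ^ (M + 1))))
  have h4 := (hasSum_C_mul (τ_small.mul_right (c (M + 1))) g).mul_left
    ((1 - (1 + X) * C (X ^ (M + 1))) * (1 - C (X ^ (M + 1)) * Z (-1)))
  simp only [g_recursion] at h4
  rw [mul_zero, sub_zero, mul_zero, sub_zero] at h3
  exact h4.unique h3

/-- The weights of the finite theta series. -/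
noncomputable def b (M : ℕ) (n : ℤ) : A := qi (M - n) * qi (M + 1 + n)

/-- The finite approximations to the theta series. -/
noncomputable def θfin (M : ℕ) : PowerSeries A := ∑' n, C (-τ n * b M n) * Z (n + 1)

lemma neg_τ_small : Small fun n => -τ n := fun n => (dvd_neg).2 (τ_small n)

lemma θfin_zero : θfin 0 = -(X * C (qi 1)) := by
  have h : ∀ n ∉ ({0, -1} : Finset ℤ), C (-τ n * b 0 n) * Z (n + 1) = 0 := fun n hn => by
    simp only [mem_insert, mem_singleton, not_or] at hn
    rcases lt_or_gt_of_ne hn.1 with h | h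
    · rw [b, qi_of_neg (show ((0 : ℕ) : ℤ) + 1 + n < 0 by push_cast; omega)]; simp
    · rw [b, qi_of_neg (show ((0 : ℕ) : ℤ) - n < 0 by push_cast; omega)]; simp
  rw [θfin, tsum_eq_sum h, sum_pair (by norm_num)]
  have : τ (-1) = -1 := by simpa using τ_reflect 0
  simp [b, this, Z_zero, Z_one]
  ring

lemma b_recursion (M : ℕ) (n : ℤ) :
    -((1 + X ^ (2 * (M + 1))) * (τ n * b M n)) + X ^ (M + 1) * (τ (n - 1) * b M (n - 1))
      + X ^ (M + 1) * (τ (n + 1) * b M (n + 1))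
    = (1 - X ^ (2 * (M + 1))) * (1 - X ^ (2 * (M + 1) + 1)) * (-τ n * b (M + 1) n) := by
  apply toFr_injective
  have t1 := toFr_τ_add_one n
  have t2 := toFr_τ_add_one (n - 1)
  have x1 := toFr_qi_mul (M + 1 - n)
  have x2 := toFr_qi_mul (M + 1 - n - 1)
  have y1 := toFr_qi_mul (M + 1 + n + 1)
  have y2 := toFr_qi_mul (M + 1 + n)
  rw [add_sub_cancel_right] at y1
  rw [sub_add_cancel] at t2
  have b1 : b M n = qi (M + 1 - n - 1) * qi (M + 1 + n) := by rw [b]; ring_nf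
  have b2 : b M (n - 1) = qi (M + 1 - n) * qi (M + 1 + n - 1) := by rw [b]; ring_nf
  have b3 : b M (n + 1) = qi (M + 1 - n - 1 - 1) * qi (M + 1 + n + 1) := by rw [b]; ring_nf
  have b4 : b (M + 1) n = qi (M + 1 - n) * qi (M + 1 + n + 1) := by
    rw [b]; push_cast; ring_nf
  have h0 := q_ne_zero
  have hn := zpow_ne_zero n h0
  have hM : q ^ (M : ℤ) = q ^ M := zpow_natCast q M
  have ht : toFr (τ (n - 1)) = -(q ^ n)⁻¹ * toFr (τ n) := by
    rw [t2]; field_simp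
  simp only [zpow_sub₀ h0, zpow_add₀ h0, zpow_one, hM] at x1 x2 y1 y2 t1
  simp only [b1, b2, b3, b4, map_add, map_neg, map_mul, map_sub, map_one, map_pow, toFr_X,
    ← x2, ← y2, ← x1, ← y1, t1, ht]
  field_simp
  ring

lemma θfin_succ (M : ℕ) :
    (1 - C (X ^ (2 * (M + 1)))) * (1 - C (X ^ (2 * (M + 1) + 1))) * θfin (M + 1)
      = (1 - (1 + X) * C (X ^ (M + 1))) * (1 - C (X ^ (M + 1)) * Z (-1)) * θfin M := by
  have h := hasSum_C_mul (neg_τ_small.mul_right (b M)) fun n => Z (n + 1)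
  change HasSum _ (θfin M) at h
  have h1 : HasSum (fun n => C (-τ (n - 1) * b M (n - 1)) * Z (n + 1)) (Z 1 * θfin M) := by
    refine ((Equiv.subRight (1 : ℤ)).hasSum_iff.2 (h.mul_left (Z 1))).congr_fun fun n => ?_
    rw [Function.comp_apply, Equiv.subRight_apply, mul_left_comm, ← Z_add]
    ring_nf
  have h2 : HasSum (fun n => C (-τ (n + 1) * b M (n + 1)) * Z (n + 1)) (Z (-1) * θfin M) := by
    refine ((Equiv.addRight (1 : ℤ)).hasSum_iff.2 (h.mul_left (Z (-1)))).congr_fun fun n => ?_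
    rw [Function.comp_apply, Equiv.coe_addRight, mul_left_comm, ← Z_add]
    ring_nf
  have h3 := ((h.mul_left (1 + C (X ^ (2 * (M + 1))))).sub
    (h1.mul_left (C (X ^ (M + 1))))).sub (h2.mul_left (C (X ^ (M + 1))))
  have h4 := (hasSum_C_mul (neg_τ_small.mul_right (b (M + 1))) fun n => Z (n + 1)).mul_left
    ((1 - C (X ^ (2 * (M + 1)))) * (1 - C (X ^ (2 * (M + 1) + 1))))
  change HasSum _ (_ * θfin (M + 1)) at h4
  refine (h4.unique (h3.congr_fun fun n => ?_)).trans ?_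
  · have := congrArg (C (R := A)) (b_recursion M n)
    simp only [map_mul, map_sub, map_one, map_add, map_neg, map_pow] at this ⊢
    linear_combination -Z (n + 1) * this
  · rw [Z_one, map_pow, map_pow]
    linear_combination -C X ^ (M + 1) * C X ^ (M + 1) * θfin M * one_add_X_mul_Z_neg_one

lemma Ffin_mul_θfin (M : ℕ) : Ffin M * θfin M = -(X * C (qi (2 * M + 1))) := by
  induction M with
  | zero => rw [Ffin_zero, θfin_zero]; simp
  | succ M ih =>
    have h1 := qi_natCast_add_one (2 * M + 1)
    have h2 := qi_natCast_add_one (2 * (M + 1))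
    push_cast at h1 h2 ih ⊢
    rw [show (2 * M : ℤ) + 1 + 1 = 2 * (M + 1) by ring] at h1
    have h3 := congrArg (C (R := A)) h1
    have h4 := congrArg (C (R := A)) h2
    simp only [map_mul, map_sub, map_one] at h3 h4
    have h5 := θfin_succ M
    have h6 := Ffin_succ M
    have h7 (k : ℕ) : (1 - C (X ^ (k + 1)) : PowerSeries A) ≠ 0 := by
      rw [← map_one C, ← map_sub]
      exact (map_ne_zero_iff _ C_injective).2 (one_sub_X_pow_succ_ne_zero k)
    refine mul_left_cancel₀ (h7 (2 * M + 1)) (mul_left_cancel₀ (h7 (2 * (M + 1))) ?_)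
    rw [show 2 * M + 1 + 1 = 2 * (M + 1) by ring] at h3
    linear_combination Ffin (M + 1) * h5 + θfin M * h6 + ih + X * h3
      + X * (1 - C (X ^ (2 * (M + 1)))) * h4

/-- The theta series `-∑ τ n (1 + s) ^ (n + 1)`. -/
noncomputable def θ : PowerSeries A := ∑' n, C (-τ n) * Z (n + 1)

lemma dvd_weight_sub_one (M : ℕ) (n : ℤ) :
    X ^ (M + 1 - n.natAbs) ∣ poch M ^ 2 * b M n - 1 := by
  have h1 := dvd_poch_mul_qi_sub_one M (M - n)
  have h2 := dvd_poch_mul_qi_sub_one M (M + 1 + n)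
  have h : poch M ^ 2 * b M n - 1 = (poch M * qi (M - n) - 1) * (poch M * qi (M + 1 + n))
      + (poch M * qi (M + 1 + n) - 1) := by rw [b]; ring
  rw [h]
  exact dvd_add (((pow_dvd_pow _ (by omega)).trans h1).mul_right _)
    ((pow_dvd_pow _ (by omega)).trans h2)

lemma C_dvd_tsum_sub {f w : ℤ → A} (hf : Small f) {M : ℕ} {a : A}
    (hw : ∀ n : ℤ, X ^ (M + 1 - n.natAbs) ∣ a * w n - 1) (k : ℤ → PowerSeries A) :
    C (X ^ M) ∣ C a * ∑' n, C (f n * w n) * k n - ∑' n, C (f n) * k n := by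
  refine C_dvd_of_forall_dvd_coeff fun j => ?_
  rw [map_sub, coeff_C_mul, coeff_tsum_C_mul (hf.mul_right w), coeff_tsum_C_mul hf,
    ← ((hf.mul_right w).mul_right _).summable.tsum_mul_left]
  have h := dvd_tsum_mul_sub (hf.mul_right fun n => coeff j (k n)) hw
  rwa [tsum_congr fun n => show f n * coeff j (k n) * (a * w n) = a * (f n * w n * coeff j (k n))
    by ring] at h

lemma coeff_F_mul_θ {j : ℕ} (hj : j ≠ 1) : coeff j (F * θ) = 0 := by
  refine eq_zero_of_forall_dvd fun M => ?_
  have h1 := C_dvd_tsum_sub τ_small (dvd_u_sub_one M) g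
  have h2 := C_dvd_tsum_sub neg_τ_small (dvd_weight_sub_one M) fun n => Z (n + 1)
  change C (X ^ M) ∣ _ * Ffin M - F at h1
  change C (X ^ M) ∣ _ * θfin M - θ at h2
  have h3 : F * θ = C (poch M ^ 2) * Ffin M * (C (poch M ^ 2) * θfin M)
      - (C (poch M ^ 2) * Ffin M * (C (poch M ^ 2) * θfin M - θ)
        + (C (poch M ^ 2) * Ffin M - F) * θ) := by ring
  have h4 : coeff j (C (poch M ^ 2) * Ffin M * (C (poch M ^ 2) * θfin M)) = 0 := by
    rw [show C (poch M ^ 2) * Ffin M * (C (poch M ^ 2) * θfin M)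
      = C (poch M ^ 2) * (C (poch M ^ 2) * (Ffin M * θfin M)) by ring, Ffin_mul_θfin,
      coeff_C_mul, coeff_C_mul, map_neg, coeff_mul_C, coeff_X, if_neg hj]
    simp
  rw [h3, map_sub, h4, zero_sub, dvd_neg]
  exact dvd_coeff_of_C_dvd (dvd_add (h2.mul_left _) (h1.mul_right _)) j

/-! ### The heat equation and its consequences -/

lemma derivative_mul_one_add_X {S : Type*} [CommRing S] (f : PowerSeries S) :
    derivative S (f * (1 + X)) = derivative S f * (1 + X) + f := by
  rw [Derivation.leibniz, map_add, Derivation.map_one_eq_zero, derivative_X]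
  simp only [smul_eq_mul]
  ring

lemma coeff_one_add_X_mul_derivative {S : Type*} [CommRing S] (f : PowerSeries S) (j : ℕ) :
    coeff j ((1 + X) * derivative S f) = (j + 1) * coeff (j + 1) f + j * coeff j f := by
  rw [add_mul, one_mul, map_add, coeff_derivative]
  cases j with
  | zero => simp
  | succ j =>
    rw [coeff_succ_X_mul, coeff_derivative]
    push_cast
    ring

lemma one_add_X_mul_derivative_Z (n : ℤ) : (1 + X) * derivative A (Z n)
    = (n : PowerSeries A) * Z n := by
  have key : ∀ m, derivative A (Z (m + 1)) = derivative A (Z m) * (1 + X) + Z m := fun m => by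
    rw [Z_add, Z_one, derivative_mul_one_add_X]
  have h0 : (1 + X : PowerSeries A) ≠ 0 := fun h => by simpa using congrArg constantCoeff h
  have hs : ∀ m, Z (m + 1) = Z m * (1 + X) := fun m => by rw [Z_add, Z_one]
  induction n with
  | zero => simp [Z_zero]
  | succ n ih =>
    rw [key, hs]
    push_cast at ih ⊢
    linear_combination (1 + X) * ih
  | pred n ih =>
    have h1 := key (-n - 1)
    have h2 := hs (-n - 1)
    rw [sub_add_cancel] at h1 h2
    rw [h1, h2] at ih
    refine mul_left_cancel₀ h0 ?_
    push_cast at ih ⊢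
    linear_combination ih

lemma intCast_mul_coeff_Z (n : ℤ) (j : ℕ) :
    (n : A) * coeff j (Z n) = (j + 1) * coeff (j + 1) (Z n) + j * coeff j (Z n) := by
  have h := congrArg (coeff j) (one_add_X_mul_derivative_Z n)
  rw [← map_intCast (C (R := A)), coeff_C_mul, coeff_one_add_X_mul_derivative] at h
  exact h.symm

/-- The coefficients of the theta series. -/
noncomputable def θc (j : ℕ) : A := coeff j θ

lemma θc_eq (j : ℕ) : θc j = ∑' n : ℤ, -τ n * coeff j (Z (n + 1)) :=
  coeff_tsum_C_mul neg_τ_small _ j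

lemma Θ_coeff_Z (n : ℤ) (j : ℕ) : Θ (coeff j (Z n)) = 0 := by
  rw [Z, binomialSeries_coeff, zsmul_one]
  exact Θ_intCast _

lemma Θ_θc (j : ℕ) : Θ (θc j) = 3 * ((j + 1) * (j + 2) * θc (j + 2)
    + 2 * j * (j + 1) * θc (j + 1) + j * (j - 1) * θc j) := by
  have hs : ∀ i, HasSum (fun n : ℤ => -τ n * coeff i (Z (n + 1))) (θc i) := fun i => by
    rw [θc_eq]
    exact (neg_τ_small.mul_right _).summable.hasSum
  have h := ((((hs (j + 2)).mul_left ((j + 1) * (j + 2) : A)).add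
    ((hs (j + 1)).mul_left (2 * j * (j + 1) : A))).add
    ((hs j).mul_left (j * (j - 1) : A))).mul_left 3
  rw [← h.tsum_eq, θc_eq, Θ_tsum (neg_τ_small.mul_right _)]
  refine tsum_congr fun n => ?_
  have h1 := intCast_mul_coeff_Z (n + 1) j
  have h2 := intCast_mul_coeff_Z (n + 1) (j + 1)
  rw [Θ_mul, Θ_coeff_Z, map_neg, Θ_τ]
  push_cast at h1 h2
  linear_combination (exp := 1) -3 * τ n * ((n + j) * h1 + (j + 1) * h2)

lemma θc_zero : θc 0 = 0 := by
  have h : ∀ n : ℤ, coeff 0 (Z n) = 1 := fun n => by rw [Z, binomialSeries_coeff]; simp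
  rw [θc_eq]
  simp only [h, mul_one]
  rw [tsum_neg, tsum_τ, neg_zero]

lemma θc_two : θc 2 = 0 := by
  have h := Θ_θc 0
  rw [θc_zero, map_zero] at h
  push_cast at h
  linear_combination -h - θc 2 * five_eq_zero

lemma Θ_θc_one : Θ (θc 1) = 3 * θc 3 := by
  rw [Θ_θc, θc_two]
  push_cast
  linear_combination 3 * θc 3 * five_eq_zero

lemma θc_four : θc 4 = -θc 3 := by
  have h := Θ_θc 2
  rw [θc_two, map_zero] at h
  push_cast at h
  linear_combination -h - (7 * θc 4 + 7 * θc 3) * five_eq_zero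

lemma Θ_θc_three : Θ (θc 3) = θc 3 := by
  rw [Θ_θc, θc_four]
  push_cast
  linear_combination (12 * θc 5 - 11 * θc 3) * five_eq_zero

lemma Θ_θc_five : Θ (θc 5) = θc 7 := by
  rw [Θ_θc]
  push_cast
  linear_combination (25 * θc 7 + 36 * θc 6 + 12 * θc 5) * five_eq_zero

lemma constantCoeff_θc_one : constantCoeff (θc 1) = -1 := by
  have hZ : ∀ n : ℤ, coeff 1 (Z n) = n := fun n => by rw [Z, binomialSeries_coeff]; simp
  have h := (neg_τ_small.mul_right fun n => coeff 1 (Z (n + 1))).dvd_sum_sub_tsum 1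
  rw [← θc_eq, pow_one, X_dvd_iff, map_sub, sub_eq_zero] at h
  rw [← h, show Icc (-((1 : ℕ) : ℤ)) ((1 : ℕ) : ℤ) = {-1, 0, 1} from rfl]
  have h1 : τ 1 = -X := by simpa using τ_add_one 0
  simp [hZ, h1]

/-- The coefficients of the theta series divided by the first one. -/
noncomputable def ρ (j : ℕ) : A := θc (j + 1) * (θc 1)⁻¹

lemma θc_one_mul_inv : θc 1 * (θc 1)⁻¹ = 1 :=
  PowerSeries.mul_inv_cancel _ (by rw [constantCoeff_θc_one]; decide)

lemma θc_one_ne_zero : θc 1 ≠ 0 := left_ne_zero_of_mul (θc_one_mul_inv ▸ one_ne_zero)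

lemma ρ_mul (j : ℕ) : ρ j * θc 1 = θc (j + 1) := by
  rw [ρ]
  linear_combination θc (j + 1) * θc_one_mul_inv

lemma ρ_zero : ρ 0 = 1 := θc_one_mul_inv

lemma ρ_one : ρ 1 = 0 := by rw [ρ, θc_two, zero_mul]

lemma ρ_three : ρ 3 = -ρ 2 := by rw [ρ, ρ, θc_four, neg_mul]

lemma Θ_ρ_two : Θ (ρ 2) = ρ 2 - 3 * ρ 2 ^ 2 := by
  have h := congrArg Θ (ρ_mul 2)
  rw [Θ_mul, Θ_θc_three, Θ_θc_one, ← ρ_mul 2] at h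
  refine mul_right_cancel₀ θc_one_ne_zero ?_
  linear_combination h

lemma Θ_ρ_four : Θ (ρ 4) = ρ 6 - 3 * ρ 2 * ρ 4 := by
  have h := congrArg Θ (ρ_mul 4)
  rw [Θ_mul, Θ_θc_five, Θ_θc_one, ← ρ_mul 2, ← ρ_mul 6] at h
  refine mul_right_cancel₀ θc_one_ne_zero ?_
  linear_combination h

/-- The series `∑ ρ j s ^ j` is the reciprocal of `F`. -/
lemma F_mul_mk_ρ : F * PowerSeries.mk ρ = 1 := by
  have h1 : θ = C (θc 1) * (X * PowerSeries.mk ρ) := by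
    ext1 j
    rw [coeff_C_mul]
    cases j with
    | zero => rw [← θc, θc_zero]; simp
    | succ j => rw [coeff_succ_X_mul, coeff_mk, mul_comm, ρ_mul]; rfl
  have h0 : coeff 0 F = 1 := by
    rw [F, coeff_tsum_C_mul τ_small]
    simp [coeff_zero_g]
  ext1 j
  rcases eq_or_ne j 0 with rfl | hj
  · rw [coeff_mul, Finset.Nat.antidiagonal_zero, sum_singleton, h0, coeff_mk, ρ_zero]
    simp
  · have h := coeff_F_mul_θ (j := j + 1) (by omega)
    rw [h1, show F * (C (θc 1) * (X * PowerSeries.mk ρ))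
      = C (θc 1) * (X * (F * PowerSeries.mk ρ)) by ring,
      coeff_C_mul, coeff_succ_X_mul] at h
    rw [(mul_eq_zero.1 h).resolve_left θc_one_ne_zero, coeff_one, if_neg hj]

/-- The coefficients of `F`. -/
noncomputable def Fc (j : ℕ) : A := coeff j F

lemma sum_Fc_mul_ρ (j : ℕ) : ∑ i ∈ range (j + 1), Fc i * ρ (j - i) = if j = 0 then 1 else 0 := by
  rw [← coeff_one, ← F_mul_mk_ρ, coeff_mul, Finset.Nat.sum_antidiagonal_eq_sum_range_succ_mk]
  simp [Fc]

lemma Fc_zero : Fc 0 = 1 := by simpa [ρ_zero] using sum_Fc_mul_ρ 0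

lemma Fc_one : Fc 1 = 0 := by
  simpa [sum_range_succ, Fc_zero, ρ_zero, ρ_one] using sum_Fc_mul_ρ 1

lemma Fc_two : Fc 2 = -ρ 2 := by
  have h := sum_Fc_mul_ρ 2
  simp [sum_range_succ, Fc_zero, Fc_one, ρ_zero] at h
  linear_combination h

lemma Fc_three : Fc 3 = ρ 2 := by
  have h := sum_Fc_mul_ρ 3
  simp [sum_range_succ, Fc_zero, Fc_one, ρ_zero, ρ_one, ρ_three] at h
  linear_combination h

lemma Fc_four : Fc 4 = ρ 2 ^ 2 - ρ 4 := by
  have h := sum_Fc_mul_ρ 4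
  simp [sum_range_succ, Fc_zero, Fc_one, Fc_two, ρ_zero, ρ_one] at h
  linear_combination h

lemma Fc_six : Fc 6 = 2 * ρ 2 * ρ 4 + ρ 2 ^ 2 - ρ 2 ^ 3 - ρ 6 := by
  have h := sum_Fc_mul_ρ 6
  simp [sum_range_succ, Fc_zero, Fc_one, Fc_two, Fc_three, Fc_four, ρ_zero, ρ_one, ρ_three] at h
  linear_combination h

lemma coeff_F_cube (j : ℕ) : coeff j (F ^ 3)
    = ∑ i ∈ range (j + 1), Fc i * ∑ k ∈ range (j - i + 1), Fc k * Fc (j - i - k) := by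
  rw [pow_succ', coeff_mul, Finset.Nat.sum_antidiagonal_eq_sum_range_succ_mk]
  simp only [sq, coeff_mul, Finset.Nat.sum_antidiagonal_eq_sum_range_succ_mk, Fc]

lemma coeff_three_F_cube : coeff 3 (F ^ 3) = 3 * ρ 2 := by
  rw [coeff_F_cube]
  simp [sum_range_succ, Fc_zero, Fc_one, Fc_two, Fc_three]
  ring

lemma coeff_four_F_cube : coeff 4 (F ^ 3) = 6 * ρ 2 ^ 2 - 3 * ρ 4 := by
  rw [coeff_F_cube]
  simp [sum_range_succ, Fc_zero, Fc_one, Fc_two, Fc_three, Fc_four]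
  ring

lemma coeff_six_F_cube : coeff 6 (F ^ 3)
    = 12 * ρ 2 * ρ 4 + 6 * ρ 2 ^ 2 - 10 * ρ 2 ^ 3 - 3 * ρ 6 := by
  rw [coeff_F_cube]
  simp [sum_range_succ, Fc_zero, Fc_one, Fc_two, Fc_three, Fc_four, Fc_six]
  ring

lemma V_zero : V 0 = -ρ 2 := by
  have h := coeff_tsum_C_mul τ_small g 2
  rw [← F, ← Fc, Fc_two] at h
  rw [h, V]
  refine tsum_congr fun n => ?_
  rw [coeff_g, sub_zero, zero_sub, d_neg]
  ring

/-! ### The differential equation modulo five -/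

lemma Θ_ofNat (n : ℕ) [n.AtLeastTwo] : Θ (ofNat(n) : A) = 0 := by
  have := Θ_intCast n
  exact_mod_cast this

/-- The series `∑ T n`, which is Euler's product. -/
noncomputable def euler : A := ∑' n, T n

lemma σ₀_eq : σ₀ = euler - 1 := rfl

lemma Θ_euler : Θ euler = -(V 0 * euler) := by
  have h := neg_coeff_F_cube 0
  rw [coeff_three_F_cube, zero_add, G_one, σ₀_eq, ← neg_neg (ρ 2), ← V_zero] at h
  simp only [zero_add, pow_one, tsum_T_mul_d_sq_mul_e, mul_zero, map_neg, map_sub,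
    Derivation.map_one_eq_zero, sub_zero] at h
  linear_combination 2 * h - (V 0 * euler + Θ euler) * five_eq_zero

lemma Θ_V_zero : Θ (V 0) = V 0 + 3 * V 0 ^ 2 := by
  rw [V_zero, map_neg, Θ_ρ_two]; ring

lemma H_eq : H = -(Θ R + V 0 * R) + V 0 + ρ 4 - 2 * V 0 ^ 2 := by
  have h := neg_coeff_F_cube 1
  rw [coeff_four_F_cube, G_two, σ₀_eq, ← neg_neg (ρ 2), ← V_zero] at h
  norm_num [Θ_euler, Nat.choose] at h
  rw [← H] at h
  linear_combination -2 * h - (H + Θ R + V 0 * R - V 0 - ρ 4 + 2 * V 0 ^ 2) * five_eq_zero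

lemma Θ_H : Θ (H + 3 * R) + V 0 * (H + 3 * R) = V 0 + ρ 6 + 4 * V 0 * ρ 4 - 2 * V 0 ^ 2 := by
  have h := neg_coeff_F_cube 3
  have h10 : (((2 + 3).choose 2 : ℕ) : A) = 0 := by
    norm_num [Nat.choose]
    linear_combination 2 * five_eq_zero
  rw [h10, zero_mul, zero_add, coeff_six_F_cube, G_four, σ₀_eq, ← neg_neg (ρ 2), ← V_zero] at h
  simp only [map_add, map_sub, Θ_mul, Θ_ofNat, Θ_euler, Derivation.map_one_eq_zero] at h ⊢
  linear_combination -2 * h + (-Θ H - 3 * R * V 0 - 3 * Θ R + V 0 - V 0 * H + 4 * V 0 * ρ 4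
    - 2 * V 0 ^ 2 - 4 * V 0 ^ 3 + ρ 6) * five_eq_zero

lemma Θ_sq_R : Θ (Θ R) + 2 * V 0 * Θ R + Θ (V 0) * R + V 0 ^ 2 * R + 2 * (Θ R + V 0 * R)
    = 2 * V 0 ^ 2 + V 0 ^ 3 := by
  have h := Θ_H
  rw [H_eq] at h
  simp only [map_add, map_sub, map_neg, sq, Θ_mul, Θ_ofNat, Θ_ρ_four, Θ_V_zero] at h ⊢
  rw [show ρ 2 = -V 0 by rw [V_zero, neg_neg]] at h
  linear_combination -h + (V 0 * R - 3 * V 0 ^ 3 + Θ R) * five_eq_zero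

lemma constantCoeff_euler : constantCoeff euler = 1 := by
  have h := dvd_poch_sub_tsum_T 1
  rw [pow_one, X_dvd_iff, map_sub, constantCoeff_poch, sub_eq_zero] at h
  exact h.symm

lemma euler_mul_inv : euler * euler⁻¹ = 1 :=
  PowerSeries.mul_inv_cancel _ (by rw [constantCoeff_euler]; decide)

lemma Θ_euler_inv : Θ euler⁻¹ = V 0 * euler⁻¹ := by
  have h := congrArg Θ euler_mul_inv
  rw [Θ_mul, Θ_euler, Derivation.map_one_eq_zero] at h
  linear_combination euler⁻¹ * h + (V 0 * euler⁻¹ - Θ euler⁻¹) * euler_mul_inv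

/-- The generating function of the smallest parts, modulo five. -/
noncomputable def sptSeries : A := euler⁻¹ * (V 0 + R)

lemma Θ_sptSeries : Θ (Θ sptSeries) + 2 * Θ sptSeries
    = Θ euler⁻¹ + 4 * Θ (Θ euler⁻¹) + 3 * Θ (Θ (Θ euler⁻¹)) := by
  have h := Θ_sq_R
  simp only [sptSeries, Θ_mul, map_add, Θ_euler_inv, Θ_V_zero, sq, Θ_ofNat] at h ⊢
  linear_combination euler⁻¹ * h
    - (V 0 + 6 * V 0 ^ 2 + 11 * V 0 ^ 3) * euler⁻¹ * five_eq_zero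

lemma coeff_sptSeries {n : ℕ} (hn : (n : ZMod 5) = 4) : coeff n sptSeries = 0 := by
  have h := congrArg (coeff n) Θ_sptSeries
  have h3 : (3 : A) = C (3 : ZMod 5) := (map_ofNat _ 3).symm
  have h2 : (2 : A) = C (2 : ZMod 5) := (map_ofNat _ 2).symm
  have h4 : (4 : A) = C (4 : ZMod 5) := (map_ofNat _ 4).symm
  simp only [h2, h3, h4, map_add, coeff_C_mul, coeff_Θ, hn] at h
  generalize coeff n sptSeries = x at *
  generalize coeff n euler⁻¹ = y at *
  revert x y
  decide

/-! ### The generating function of the smallest parts -/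

/-- The character selecting partitions with all parts in `[k + 1, N]`, weighted by `w` at the
multiplicity of `k + 1`. -/
def character (w : ℕ → ZMod 5) (N k i m : ℕ) : ZMod 5 :=
  if i = k + 1 then w m else if k < i ∧ i ≤ N then 1 else 0

lemma one_sub_mul_tsum (i : ℕ) :
    (1 - X ^ (i + 1) : A) * (1 + ∑' j, (1 : ZMod 5) • X ^ ((i + 1) * (j + 1))) = 1 := by
  have hs := Nat.Partition.summable_genFun_term (fun _ _ => (1 : ZMod 5)) i
  have h := hs.tsum_eq_zero_add
  simp only [one_smul] at hs h ⊢
  have h2 : ∑' j, (X : A) ^ ((i + 1) * (j + 1 + 1))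
      = X ^ (i + 1) * ∑' j, (X : A) ^ ((i + 1) * (j + 1)) := by
    rw [← hs.tsum_mul_left]
    exact tsum_congr fun j => by ring
  rw [h2] at h
  simp only [zero_add, mul_one] at h
  linear_combination h

lemma one_sub_mul_tsum_weighted (k : ℕ) :
    (1 - X ^ (k + 1) : A) * ∑' j : ℕ, ((j + 1 : ℕ) : ZMod 5) • X ^ ((k + 1) * (j + 1))
      = X ^ (k + 1) * d (k + 1) := by
  have hs := Nat.Partition.summable_genFun_term (fun _ m => ((m : ℕ) : ZMod 5)) k
  have hs1 := Nat.Partition.summable_genFun_term (fun _ _ => (1 : ZMod 5)) k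
  have h := hs.tsum_eq_zero_add
  have h1 := one_sub_mul_tsum k
  have h2 : ∑' j : ℕ, ((j + 1 + 1 : ℕ) : ZMod 5) • (X : A) ^ ((k + 1) * (j + 1 + 1))
      = X ^ (k + 1) * ∑' j : ℕ, ((j + 1 : ℕ) : ZMod 5) • (X : A) ^ ((k + 1) * (j + 1))
        + X ^ (k + 1) * ∑' j : ℕ, (1 : ZMod 5) • (X : A) ^ ((k + 1) * (j + 1)) := by
    rw [← hs.tsum_mul_left, ← hs1.tsum_mul_left,
      ← (hs.mul_left _).tsum_add (hs1.mul_left _)]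
    refine tsum_congr fun j => ?_
    simp only [smul_eq_C_mul]
    push_cast
    rw [map_add _ ((j : ZMod 5) + 1)]
    ring
  rw [h2] at h
  simp only [zero_add, mul_one, Nat.cast_one, one_smul] at h h1 ⊢
  linear_combination h + X ^ (k + 1) * d (k + 1) * h1
    - X ^ (k + 1) * (1 + ∑' j, X ^ ((k + 1) * (j + 1))) * one_sub_X_pow_mul_d k

lemma genFun_character (w : ℕ → ZMod 5) {N k : ℕ} (hk : k < N) :
    poch N * Nat.Partition.genFun (character w N k)
      = poch k * ((1 - X ^ (k + 1)) * (1 + ∑' j, w (j + 1) • X ^ ((k + 1) * (j + 1)))) := by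
  rw [Nat.Partition.genFun_eq_tprod, tprod_eq_prod (s := range N), poch, ← prod_mul_distrib,
    ← prod_range_mul_prod_Ico _ hk, prod_range_succ, prod_eq_one (s := Ico (k + 1) N), mul_one]
  · congr 1
    · refine prod_congr rfl fun i hi => ?_
      rw [mem_range] at hi
      simp [character, hi.ne, hi.not_ge]
    · simp [character]
  · intro i hi
    rw [mem_Ico] at hi
    have := one_sub_mul_tsum i
    simpa [character, show i ≠ k by omega, show k ≤ i by omega, show i + 1 ≤ N by omega] using this
  · intro i hi
    rw [mem_range] at hi
    simp [character, show i ≠ k by omega, show ¬ i + 1 ≤ N by omega]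

lemma prod_character (w : ℕ → ZMod 5) {n N k : ℕ} (hn : n ≤ N) (p : Nat.Partition n) :
    p.parts.toFinsupp.prod (character w N k)
      = if ∀ i ∈ p.parts, k + 1 ≤ i then
          if k + 1 ∈ p.parts then w (p.parts.count (k + 1)) else 1
        else 0 := by
  simp only [Finsupp.prod, Multiset.toFinsupp_support, Multiset.toFinsupp_apply]
  split_ifs with h h1
  · rw [prod_eq_single_of_mem (k + 1) (by simpa using h1)]
    · simp [character]
    · intro i hi hik
      rw [Multiset.mem_toFinset] at hi
      have h2 := h i hi
      have h3 := p.le_of_mem_parts hi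
      simp [character, hik, show k < i by omega, show i ≤ N by omega]
  · refine prod_eq_one fun i hi => ?_
    rw [Multiset.mem_toFinset] at hi
    have h2 := h i hi
    have h3 := p.le_of_mem_parts hi
    simp [character, show i ≠ k + 1 from fun hik => h1 (hik ▸ hi), show k < i by omega,
      show i ≤ N by omega]
  · push Not at h
    obtain ⟨i, hi, hik⟩ := h
    refine prod_eq_zero (Multiset.mem_toFinset.2 hi) ?_
    simp [character, hik.ne, show ¬ k < i by omega]

/-- The generating function of the multiplicity of `k + 1` as a smallest part. -/
noncomputable def multiplicitySeries (N k : ℕ) : A :=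
  Nat.Partition.genFun (character (fun m => (m : ZMod 5)) N k)
    - Nat.Partition.genFun (character (fun _ => 0) N k)

lemma poch_mul_multiplicitySeries {N k : ℕ} (hk : k < N) :
    poch N * multiplicitySeries N k = X ^ (k + 1) * (poch k * d (k + 1)) := by
  rw [multiplicitySeries, mul_sub, genFun_character _ hk, genFun_character _ hk, ← mul_sub,
    ← mul_sub]
  simp only [zero_smul, tsum_zero, add_zero, add_sub_cancel_left]
  rw [one_sub_mul_tsum_weighted]
  ring

lemma coeff_multiplicitySeries {n N k : ℕ} (hn : n ≤ N) :
    coeff n (multiplicitySeries N k) = ∑ p : Nat.Partition n,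
      (((p.parts.filter fun j => ∀ i ∈ p.parts, j ≤ i).count (k + 1) : ℕ) : ZMod 5) := by
  rw [multiplicitySeries, map_sub, Nat.Partition.coeff_genFun, Nat.Partition.coeff_genFun,
    ← sum_sub_distrib]
  refine sum_congr rfl fun p _ => ?_
  rw [prod_character _ hn, prod_character _ hn, Multiset.count_filter]
  split_ifs with h h1
  · simp
  · simp [Multiset.count_eq_zero_of_notMem h1]
  · simp

lemma natCast_spt {n N : ℕ} (hn : n ≤ N) :
    (spt n : ZMod 5) = coeff n (∑ k ∈ range N, multiplicitySeries N k) := by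
  rw [map_sum, sum_congr rfl fun k _ => coeff_multiplicitySeries hn, sum_comm, spt, Nat.cast_sum]
  refine sum_congr rfl fun p _ => ?_
  rw [← Nat.cast_sum, ← Multiset.sum_count_eq_card (s := (range N).map (addRightEmbedding 1))]
  · simp
  · intro i hi
    have hi := Multiset.mem_of_mem_filter hi
    have h1 := p.parts_pos hi
    have h2 := p.le_of_mem_parts hi
    simp only [mem_map, mem_range, addRightEmbedding_apply]
    exact ⟨i - 1, by omega, by omega⟩

lemma natCast_spt_eq_coeff (n : ℕ) : (spt n : ZMod 5) = coeff n sptSeries := by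
  rw [natCast_spt n.le_succ, ← sub_eq_zero, ← map_sub]
  suffices X ^ (n + 1) ∣ ∑ k ∈ range (n + 1), multiplicitySeries (n + 1) k - sptSeries from
    X_pow_dvd_iff.1 this n n.lt_succ_self
  have h1 := dvd_sum_poch_sub (n + 1)
  have h2 := dvd_poch_sub_tsum_T (n + 1)
  rw [← sum_congr rfl fun k hk => poch_mul_multiplicitySeries (mem_range.1 hk), ← mul_sum] at h1
  have h3 := dvd_sub h1 (h2.mul_right (∑ k ∈ range (n + 1), multiplicitySeries (n + 1) k))
  convert h3.mul_left euler⁻¹ using 1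
  rw [sptSeries]
  change _ = euler⁻¹ * (_ - (_ - euler) * _)
  linear_combination (-∑ k ∈ range (n + 1), multiplicitySeries (n + 1) k) * euler_mul_inv

end SptCongruence

/-- Andrews' congruence for `spt` modulo 5. -/
theorem spt_congruence_mod_five (n : ℕ) (h : 24 ∣ 5 * n + 1) :
    5 ∣ spt ((5 * n + 1) / 24) := by
  have hm : ((5 * n + 1) / 24) % 5 = 4 := by omega
  rw [← ZMod.natCast_eq_zero_iff, SptCongruence.natCast_spt_eq_coeff]
  refine SptCongruence.coeff_sptSeries ?_
  rw [← ZMod.natCast_mod, hm]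
  rfl
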